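/- Multivariate hook length formula for d-complete posets: let P be a d-complete poset with n elements, {x_D} indeterminates indexed by the diagonals of P, and H_p(x) = Σ_D h_P^{(D)}(p) x_D the hook polynomial of each p ∈ P. For a linear extension T: p₁ > p₂ > ⋯ > pₙ define weight(T)⁻¹ = Π_{i=1}^{n} Σ_{j=i}^{n} x_{D(p_j)}. Then Σ_T weight(T) = 1 / Π_{p∈P} H_p(x), where the sum is over all linear extensions T of P. -/

import Mathlib

variable {P : Type*} [PartialOrder P]

/-- A subset `S` of a poset is convex if it contains every element lying
between two of its elements. -/
def IsConvexSet (S : Set P) : Prop :=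
  ∀ a ∈ S, ∀ b ∈ S, ∀ x, a ≤ x → x ≤ b → x ∈ S

/-- `S` has the structure of (an order ideal of) `d_k(1)` with side elements `w`, `z`:
`w` and `z` are incomparable, every other element of `S` lies below both or above
both of them, the elements below them (the tail) form a chain of `k - 2` elements,
and the elements above them (the neck) form a chain. -/
def DkStruct (k : ℕ) (S : Set P) (w z : P) : Prop :=
  3 ≤ k ∧ w ∈ S ∧ z ∈ S ∧ ¬ w ≤ z ∧ ¬ z ≤ w ∧
  (∀ x ∈ S, x = w ∨ x = z ∨ (x ≤ w ∧ x ≤ z) ∨ (w ≤ x ∧ z ≤ x)) ∧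
  IsChain (· ≤ ·) {x ∈ S | x ≤ w ∧ x ≤ z} ∧
  IsChain (· ≤ ·) {x ∈ S | w ≤ x ∧ z ≤ x} ∧
  {x ∈ S | x ≤ w ∧ x ≤ z}.ncard = k - 2

/-- The interval `[a, b]` is a `d_k`-interval (isomorphic to `d_k(1)`)
with side elements `w` and `z`. -/
def IsDkIntervalWith (k : ℕ) (a b w z : P) : Prop :=
  a ≤ b ∧ DkStruct k (Set.Icc a b) w z ∧
    {x ∈ Set.Icc a b | w ≤ x ∧ z ≤ x}.ncard = k - 2

/-- The interval `[a, b]` is a `d_k`-interval. -/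
def IsDkInterval (k : ℕ) (a b : P) : Prop := ∃ w z, IsDkIntervalWith k a b w z

/-- The interval `[a, b]` is a `d`-interval. -/
def IsDInterval (a b : P) : Prop := ∃ k, IsDkInterval k a b

/-- The interval `[a, b]` is a `d`-interval with side elements `w` and `z`. -/
def IsDIntervalWith (a b w z : P) : Prop := ∃ k, IsDkIntervalWith k a b w z

/-- `p` is a neck element of the `d`-interval `[a, b]`. -/
def IsNeckOf (p a b : P) : Prop :=
  ∃ k w z, IsDkIntervalWith k a b w z ∧ p ∈ Set.Icc a b ∧ w ≤ p ∧ z ≤ p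

/-- `p` is a tail element of the `d`-interval `[a, b]`. -/
def IsTailOf (p a b : P) : Prop :=
  ∃ k w z, IsDkIntervalWith k a b w z ∧ p ∈ Set.Icc a b ∧ p ≤ w ∧ p ≤ z

/-- `S` is a `d_k^-`-convex set: a convex subset isomorphic to `d_k(1)` minus
its maximum (so the neck has `k - 3` elements). -/
def IsDkMinusConvex (k : ℕ) (S : Set P) : Prop :=
  IsConvexSet S ∧ ∃ w z, DkStruct k S w z ∧
    {x ∈ S | w ≤ x ∧ z ≤ x}.ncard = k - 3

/-- Proctor's axioms for a d-complete poset: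
(1) every `d_k^-`-convex set can be completed above to a `d_k`-interval;
(2) the maximum of any `d`-interval covers no element outside the interval;
(3) no two `d^-`-convex sets differ only in their minimal elements. -/
def IsDComplete (P : Type*) [PartialOrder P] : Prop :=
  (∀ (k : ℕ) (S : Set P), IsDkMinusConvex k S →
      ∃ z, z ∉ S ∧ ∃ a, IsDkInterval k a z ∧ Set.Icc a z = insert z S) ∧
  (∀ a b : P, IsDInterval a b → ∀ x, x ⋖ b → x ∈ Set.Icc a b) ∧
  (∀ (k k' : ℕ) (S T : Set P), IsDkMinusConvex k S → IsDkMinusConvex k' T →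
      ∀ s ∈ S, ∀ t ∈ T, (∀ x ∈ S, s ≤ x) → (∀ x ∈ T, t ≤ x) →
        S \ {s} = T \ {t} → S = T)

/-- Two elements are in the same diagonal: the equivalence relation generated by
`p ∼ q` whenever `[p, q]` is a `d`-interval. -/
def DiagRel {P : Type*} [PartialOrder P] (a b : P) : Prop :=
  Relation.EqvGen (fun x y => IsDInterval x y) a b

/-- The setoid on `P` whose classes are the diagonals. -/
def diagSetoid (P : Type*) [PartialOrder P] : Setoid P :=
  ⟨DiagRel, Relation.EqvGen.is_equivalence _⟩

/-- `h` is the hook-vector function of the d-complete poset `P`, indexed by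
diagonals (the quotient of `P` by `DiagRel`): if `p` is not a neck element of any
`d`-interval then `h p D` counts the elements of the diagonal `D` weakly below `p`;
and if `[p', p]` is a `d`-interval with side elements `w`, `z`, then
`h p = h w + h z - h p'`. -/
def IsHookVector {P : Type*} [PartialOrder P]
    (h : P → Quotient (diagSetoid P) → ℤ) : Prop :=
  (∀ p : P, (¬ ∃ a b : P, IsNeckOf p a b) → ∀ D,
      h p D = ({r : P | Quotient.mk (diagSetoid P) r = D ∧ r ≤ p}).ncard) ∧
  (∀ p' p w z : P, IsDIntervalWith p' p w z → ∀ D,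
      h p D = h w D + h z D - h p' D)

/-- A linear extension of `P`, as an enumeration `e 0 > e 1 > ⋯` refining the
partial order: each initial segment is an upper set. -/
def IsLinExt {P : Type*} [PartialOrder P] [Fintype P]
    (e : Fin (Fintype.card P) ≃ P) : Prop :=
  ∀ i j, e i < e j → j < i

open scoped Classical

set_option linter.unusedSectionVars false

structure HeapAx {P L : Type*} [PartialOrder P] [Fintype P] (lab : P → L)
    (Adj : L → L → Prop) : Prop where
  symm : ∀ i j, Adj i j → Adj j i
  irrefl : ∀ i, ¬ Adj i i
  h1 : ∀ a b, lab a = lab b → a ≤ b ∨ b ≤ a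
  h2 : ∀ a b, Adj (lab a) (lab b) → a ≤ b ∨ b ≤ a
  h3 : ∀ a b, a ⋖ b → Adj (lab a) (lab b)
  h4 : ∀ a b, a < b → lab a = lab b → (∀ c, a < c → c < b → lab c ≠ lab a) →
    (Finset.univ.filter (fun r => a < r ∧ r < b ∧ Adj (lab a) (lab r))).card = 2
  h5 : ∀ a, (∀ b, a < b → lab b ≠ lab a) →
    (Finset.univ.filter (fun r => a < r ∧ Adj (lab a) (lab r))).card ≤ 1

noncomputable section HeapPart

variable {P L : Type*} [PartialOrder P] [Fintype P] {lab : P → L} {Adj : L → L → Prop}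

def ca (Adj : L → L → Prop) (i j : L) : ℤ := if i = j then 2 else if Adj i j then -1 else 0

def cc (lab : P → L) (Adj : L → L → Prop) (i : L) (A : Finset P) : ℤ :=
  ∑ r ∈ A, ca Adj i (lab r)

def qf (lab : P → L) (Adj : L → L → Prop) (B : Finset P) : ℤ :=
  ∑ r ∈ B, cc lab Adj (lab r) B

def Up (F : Finset P) : Prop := ∀ a ∈ F, ∀ b, a ≤ b → b ∈ F

theorem ca_self (i : L) : ca Adj i i = 2 := by simp [ca]

theorem HeapAx.ca_symm (H : HeapAx lab Adj) (i j : L) : ca Adj i j = ca Adj j i := by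
  unfold ca
  have := H.symm i j
  have := H.symm j i
  grind

theorem HeapAx.cmp (H : HeapAx lab Adj) {a r : P} (h : ca Adj (lab a) (lab r) ≠ 0) :
    r < a ∨ r = a ∨ a < r := by
  unfold ca at h
  have : a ≤ r ∨ r ≤ a := by
    split_ifs at h with h1 h2
    · exact H.h1 _ _ h1
    · exact H.h2 _ _ h2
    · simp at h
  rcases this with h | h
  · rcases h.eq_or_lt with h | h
    · exact Or.inr (Or.inl h.symm)
    · exact Or.inr (Or.inr h)
  · rcases h.eq_or_lt with h | h
    · exact Or.inr (Or.inl h)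
    · exact Or.inl h

theorem HeapAx.split (H : HeapAx lab Adj) (A : Finset P) (a : P) :
    cc lab Adj (lab a) A = cc lab Adj (lab a) (A.filter (· < a)) + (if a ∈ A then 2 else 0)
      + cc lab Adj (lab a) (A.filter (a < ·)) := by
  have e1 : (if a ∈ A then (2:ℤ) else 0) = ∑ r ∈ A, if r = a then ca Adj (lab a) (lab r) else 0 := by
    rw [Finset.sum_ite_eq' A a]
    simp [ca_self]
  unfold cc
  rw [e1, Finset.sum_filter, Finset.sum_filter, ← Finset.sum_add_distrib, ← Finset.sum_add_distrib]
  refine Finset.sum_congr rfl fun r _ => ?_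
  by_cases h0 : ca Adj (lab a) (lab r) = 0
  · simp [h0]
  · rcases H.cmp h0 with h | h | h
    · simp [h, h.ne, h.not_gt]
    · simp [h]
    · simp [h, h.ne', h.not_gt]

theorem cc_eq_neg_card (A : Finset P) (i : L) (h : ∀ r ∈ A, lab r ≠ i) :
    cc lab Adj i A = - ((A.filter (fun r => Adj i (lab r))).card : ℤ) := by
  unfold cc
  rw [Finset.card_filter]
  push_cast
  rw [← Finset.sum_neg_distrib]
  refine Finset.sum_congr rfl fun r hr => ?_
  unfold ca
  rw [if_neg (fun h' => h r hr h'.symm)]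
  split_ifs <;> simp

theorem HeapAx.inter (H : HeapAx lab Adj) {a b : P} (hab : a < b) (hl : lab a = lab b)
    (hc : ∀ c, a < c → c < b → lab c ≠ lab a) :
    cc lab Adj (lab a) (Finset.univ.filter (fun r => a < r ∧ r < b)) = -2 := by
  rw [cc_eq_neg_card]
  · have := H.h4 a b hab hl hc
    rw [Finset.filter_filter]
    simp only [and_assoc]
    rw [this]; rfl
  · intro r hr
    simp at hr
    exact hc r hr.1 hr.2

/-- next lower element with the same label, within `Q` -/
theorem exists_pred (Q : Finset P) (hQ : Up Q) {m q : P} (hm : m ∈ Q) (hmq : m < q)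
    (hl : lab m = lab q) : ∃ a ∈ Q, m ≤ a ∧ a < q ∧ lab a = lab q ∧
      ∀ c, a < c → c < q → lab c ≠ lab a := by
  obtain ⟨a, ha, hmax⟩ := (Q.filter (fun a => m ≤ a ∧ a < q ∧ lab a = lab q)).exists_maximal
    ⟨m, by simp [hm, hmq, hl]⟩
  simp only [Finset.mem_filter] at ha hmax
  refine ⟨a, ha.1, ha.2.1, ha.2.2.1, ha.2.2.2, fun c hac hcq hlc => ?_⟩
  have := hmax (y := c) ⟨hQ a ha.1 c hac.le, ha.2.1.trans hac.le, hcq, hlc.trans ha.2.2.2⟩ hac.le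
  exact absurd this hac.not_ge

theorem exists_succ {m q : P} (hmq : m < q)
    (hl : lab m = lab q) : ∃ a, m < a ∧ a ≤ q ∧ lab a = lab m ∧
      ∀ c, m < c → c < a → lab c ≠ lab m := by
  obtain ⟨a, ha, hmax⟩ := (Finset.univ.filter (fun a => m < a ∧ a ≤ q ∧ lab a = lab m)).exists_minimal
    ⟨q, by simp [hmq, hl]⟩
  simp only [Finset.mem_filter, Finset.mem_univ, true_and] at ha hmax
  refine ⟨a, ha.1, ha.2.1, ha.2.2, fun c hac hcq hlc => ?_⟩
  have := hmax (y := c) ⟨hac, hcq.le.trans ha.2.1, hlc⟩ hcq.le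
  exact absurd this hcq.not_ge

theorem HeapAx.lower (H : HeapAx lab Adj) (Q : Finset P) (hQ : Up Q) {m : P} (hm : m ∈ Q)
    (hmin : ∀ r ∈ Q, ¬ r < m) (q : P) : q ∈ Q → lab q = lab m →
    cc lab Adj (lab m) (Q.filter (· < q)) = 0 := by
  induction q using WellFoundedLT.induction with
  | ind q ih =>
  intro hq hl
  rcases (H.h1 m q hl.symm) with h | h
  · rcases h.eq_or_lt with rfl | h
    · rw [Finset.filter_false_of_mem hmin]; simp [cc]
    · obtain ⟨a, haQ, hma, haq, hla, hc⟩ := exists_pred Q hQ hm h hl.symm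
      have hlm : lab a = lab m := hla.trans hl
      rw [← hlm, H.split _ a]
      have e1 : (Q.filter (· < q)).filter (· < a) = Q.filter (· < a) := by
        ext r; simp only [Finset.mem_filter]
        constructor
        · rintro ⟨⟨h1, h2⟩, h3⟩; exact ⟨h1, h3⟩
        · rintro ⟨h1, h3⟩; exact ⟨⟨h1, h3.trans haq⟩, h3⟩
      have e2 : (Q.filter (· < q)).filter (a < ·) = Finset.univ.filter (fun r => a < r ∧ r < q) := by
        ext r; simp only [Finset.mem_filter, Finset.mem_univ, true_and]
        constructor
        · rintro ⟨⟨h1, h2⟩, h3⟩; exact ⟨h3, h2⟩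
        · rintro ⟨h1, h3⟩; exact ⟨⟨hQ a haQ r h1.le, h3⟩, h1⟩
      rw [e1, e2, H.inter haq hla hc, if_pos (by simp [haQ, haq])]
      have := ih a haq haQ hlm
      rw [← hlm] at this
      rw [this]; rfl
  · rcases h.eq_or_lt with rfl | h
    · rw [Finset.filter_false_of_mem hmin]; simp [cc]
    · exact absurd h (hmin q hq)

theorem HeapAx.upper (H : HeapAx lab Adj) (q : P) :
    -1 ≤ cc lab Adj (lab q) (Finset.univ.filter (q < ·)) := by
  induction q using WellFoundedGT.induction with
  | ind q ih =>
  by_cases hex : ∃ b, q < b ∧ lab b = lab q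
  · obtain ⟨b, hb, hlb⟩ := hex
    obtain ⟨a, hqa, -, hla, hc⟩ := exists_succ hb hlb.symm
    rw [← hla, H.split _ a]
    have e1 : (Finset.univ.filter (q < ·)).filter (· < a) =
        Finset.univ.filter (fun r => q < r ∧ r < a) := by
      rw [Finset.filter_filter]
    have e2 : (Finset.univ.filter (q < ·)).filter (a < ·) = Finset.univ.filter (a < ·) := by
      ext r; simp only [Finset.mem_filter, Finset.mem_univ, true_and]
      exact ⟨fun h => h.2, fun h => ⟨hqa.trans h, h⟩⟩
    rw [e1, e2, if_pos (by simp [hqa])]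
    have := ih a hqa
    have h2 := H.inter hqa hla.symm hc
    rw [hla] at this ⊢
    omega
  · push Not at hex
    rw [cc_eq_neg_card _ _ (by simpa using hex), Finset.filter_filter]
    have := H.h5 q hex
    omega

theorem HeapAx.qf_insert (H : HeapAx lab Adj) (B : Finset P) (r : P) (hr : r ∉ B) :
    qf lab Adj (insert r B) = qf lab Adj B + 2 * cc lab Adj (lab r) B + 2 := by
  have e : ∀ i, cc lab Adj i (insert r B) = ca Adj i (lab r) + cc lab Adj i B := fun i => by
    unfold cc; rw [Finset.sum_insert hr]
  unfold qf
  rw [Finset.sum_insert hr]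
  simp only [e]
  rw [Finset.sum_add_distrib, ca_self]
  have : ∑ x ∈ B, ca Adj (lab x) (lab r) = cc lab Adj (lab r) B := by
    unfold cc
    exact Finset.sum_congr rfl fun x _ => H.ca_symm _ _
  rw [this]; ring

theorem qf_congr {B C : Finset P}
    (f : P → P) (hf : Set.InjOn f B) (hC : B.image f = C) (hl : ∀ r ∈ B, lab (f r) = lab r) :
    qf lab Adj C = qf lab Adj B := by
  subst hC
  unfold qf cc
  rw [Finset.sum_image hf]
  refine Finset.sum_congr rfl fun x hx => ?_
  rw [Finset.sum_image hf]
  refine Finset.sum_congr rfl fun y hy => ?_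
  rw [hl x hx, hl y hy]

theorem HeapAx.qf_pos (H : HeapAx lab Adj) (n : ℕ) : ∀ B : Finset P, B.Nonempty →
    ∑ r ∈ B, (Finset.univ.filter (r ≤ ·)).card = n → 0 < qf lab Adj B := by
  induction n using Nat.strong_induction_on with
  | _ n ih =>
  intro B hB hn
  by_contra hneg
  push Not at hneg
  -- label-up-closed
  have hup : ∀ r ∈ B, ∀ s, r < s → lab s = lab r → s ∈ B := by
    intro r hr s hrs hl
    by_contra hs
    set C := insert s (B.erase r)
    have hsC : s ∉ B.erase r := fun h => hs (Finset.mem_of_mem_erase h)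
    have h1 : qf lab Adj C = qf lab Adj B := by
      apply qf_congr (fun x => if x = r then s else x)
      · intro x hx y hy hxy
        simp only at hxy
        split_ifs at hxy with h1 h2 h2
        · rw [h1, h2]
        · exact absurd (hxy ▸ hy) hs
        · exact absurd (hxy ▸ hx) hs
        · exact hxy
      · ext x
        simp only [Finset.mem_image, C, Finset.mem_insert, Finset.mem_erase]
        constructor
        · rintro ⟨y, hy, rfl⟩
          split_ifs with h
          · exact Or.inl rfl
          · exact Or.inr ⟨h, hy⟩
        · rintro (rfl | ⟨h1, h2⟩)
          · exact ⟨r, hr, by simp⟩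
          · exact ⟨x, h2, by simp [h1]⟩
      · intro x hx
        split_ifs with h
        · rw [hl, h]
        · rfl
    have hlt : (Finset.univ.filter (s ≤ ·)).card < (Finset.univ.filter (r ≤ ·)).card := by
      apply Finset.card_lt_card
      rw [Finset.ssubset_iff_of_subset]
      · exact ⟨r, by simp, by simp [hrs.not_ge]⟩
      · intro x; simp only [Finset.mem_filter, Finset.mem_univ, true_and]
        exact fun h => hrs.le.trans h
    have := ih (∑ r ∈ C, (Finset.univ.filter (r ≤ ·)).card) (by
      rw [← hn, Finset.sum_insert hsC, ← Finset.add_sum_erase B _ hr]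
      omega) C ⟨s, by simp [C]⟩ rfl
    omega
  obtain ⟨q, hq, hmin⟩ := B.exists_minimal hB
  have hc : cc lab Adj (lab q) B ≤ 0 := by
    by_contra hc
    push Not at hc
    have hqe := H.qf_insert (B.erase q) q (by simp)
    rw [Finset.insert_erase hq] at hqe
    have hcc : cc lab Adj (lab q) B = 2 + cc lab Adj (lab q) (B.erase q) := by
      unfold cc
      rw [← Finset.add_sum_erase B _ hq, ca_self]
    by_cases hne : (B.erase q).Nonempty
    · have hpos : 0 < (Finset.univ.filter (q ≤ ·)).card := Finset.card_pos.2 ⟨q, by simp⟩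
      have := ih (∑ r ∈ B.erase q, (Finset.univ.filter (r ≤ ·)).card) (by
        rw [← hn, ← Finset.add_sum_erase B _ hq]
        omega) (B.erase q) hne rfl
      omega
    · rw [Finset.not_nonempty_iff_eq_empty] at hne
      rw [hne] at hqe
      simp [qf, cc] at hqe
      unfold qf cc at hneg
      omega
  rw [H.split B q, if_pos hq] at hc
  have h0 : B.filter (· < q) = ∅ := by
    rw [Finset.filter_eq_empty_iff]
    intro x hx hxq
    exact absurd (hmin hx hxq.le) hxq.not_ge
  rw [h0] at hc
  have hu := H.upper q
  have : cc lab Adj (lab q) (Finset.univ.filter (q < ·)) ≤ cc lab Adj (lab q) (B.filter (q < ·)) := by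
    unfold cc
    rw [← Finset.sum_filter_add_sum_filter_not (Finset.univ.filter (q < ·)) (· ∈ B)]
    have : (Finset.univ.filter (q < ·)).filter (· ∈ B) = B.filter (q < ·) := by
      ext x; simp [and_comm]
    rw [this]
    have : ∑ x ∈ (Finset.univ.filter (q < ·)).filter (· ∉ B), ca Adj (lab q) (lab x) ≤ 0 := by
      apply Finset.sum_nonpos
      intro x hx
      simp at hx
      unfold ca
      rw [if_neg (fun h => hx.2 (hup q hq x hx.1 h.symm))]
      split_ifs <;> simp
    omega
  simp [cc] at hc hu this
  omega

end HeapPart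

noncomputable section HeapPartB

variable {P L : Type*} [PartialOrder P] [Fintype P] {lab : P → L} {Adj : L → L → Prop}

def addable (Q F : Finset P) : Finset P := (Q \ F).filter (fun p => ∀ r, p < r → r ∈ F)

def Rem (lab : P → L) (i : L) (F : Finset P) : Finset P :=
  F.filter (fun q => lab q = i ∧ ∀ r ∈ F, ¬ r < q)

theorem mem_addable {Q F : Finset P} {p : P} :
    p ∈ addable Q F ↔ p ∈ Q ∧ p ∉ F ∧ ∀ r, p < r → r ∈ F := by
  simp [addable, and_assoc]

theorem mem_Rem {i : L} {F : Finset P} {p : P} :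
    p ∈ Rem lab i F ↔ p ∈ F ∧ lab p = i ∧ ∀ r ∈ F, ¬ r < p := by
  simp [Rem]

theorem HeapAx.lt_or (H : HeapAx lab Adj) {a b : P} (h : lab a = lab b) : a < b ∨ a = b ∨ b < a := by
  rcases H.h1 a b h with h | h <;> rcases h.eq_or_lt with h | h <;> simp [h]

theorem HeapAx.lt_or' (H : HeapAx lab Adj) {a b : P} (h : Adj (lab a) (lab b)) : a < b ∨ b < a := by
  have hne : a ≠ b := by rintro rfl; exact H.irrefl _ h
  rcases H.h2 a b h with h | h
  · exact Or.inl (lt_of_le_of_ne h hne)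
  · exact Or.inr (lt_of_le_of_ne h hne.symm)

/-- the count reduces to elements above the top `i`-element of the complement -/
theorem HeapAx.red (H : HeapAx lab Adj) (Q A : Finset P) (hQ : Up Q) {m : P} (hm : m ∈ Q)
    (hmin : ∀ r ∈ Q, ¬ r < m) (hAQ : A ⊆ Q) (hA : ∀ a ∈ A, ∀ b ∈ Q, b ≤ a → b ∈ A)
    {q : P} (hq : q ∈ A) (hl : lab q = lab m) :
    cc lab Adj (lab m) A = 2 + cc lab Adj (lab m) (A.filter (q < ·)) := by
  have h0 := H.lower Q hQ hm hmin q (hAQ hq) hl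
  rw [← hl] at h0 ⊢
  rw [H.split A q, if_pos hq]
  have : A.filter (· < q) = Q.filter (· < q) := by
    ext r; simp only [Finset.mem_filter]
    exact ⟨fun h => ⟨hAQ h.1, h.2⟩, fun h => ⟨hA q hq r h.1 h.2.le, h.2⟩⟩
  rw [this, h0]; ring

section T
variable (H : HeapAx lab Adj) {Q F : Finset P} (hQ : Up Q) (hF : Up F) (hFQ : F ⊆ Q) {m : P}
  (hm : m ∈ Q) (hmF : m ∉ F) (hmin : ∀ r ∈ Q, ¬ r < m)

include H hQ hF hm hmin in
theorem T_red {q : P} (hq : q ∈ Q) (hqF : q ∉ F) (hl : lab q = lab m) :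
    cc lab Adj (lab m) (Q \ F) = 2 + cc lab Adj (lab m) ((Q \ F).filter (q < ·)) := by
  refine H.red Q _ hQ hm hmin Finset.sdiff_subset ?_ (by simp [hq, hqF]) hl
  intro a ha b hb hba
  simp only [Finset.mem_sdiff] at ha ⊢
  exact ⟨hb, fun h => ha.2 (hF b h a hba)⟩

include H hQ hF hm hmin in
theorem T0 {q : P} (hq : q ∈ addable Q F) (hl : lab q = lab m) :
    cc lab Adj (lab m) (Q \ F) = 2 ∧ Rem lab (lab m) F = ∅ := by
  rw [mem_addable] at hq
  constructor
  · rw [T_red H hQ hF hm hmin hq.1 hq.2.1 hl]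
    have : (Q \ F).filter (q < ·) = ∅ := by
      rw [Finset.filter_eq_empty_iff]
      intro x hx hqx
      exact (Finset.mem_sdiff.1 hx).2 (hq.2.2 x hqx)
    rw [this]; simp [cc]
  · rw [Finset.eq_empty_iff_forall_notMem]
    intro p hp
    rw [mem_Rem] at hp
    have hlt : q < p := by
      rcases H.lt_or (hl.trans hp.2.1.symm) with h | h | h
      · exact h
      · exact absurd (h ▸ hp.1) hq.2.1
      · exact absurd (hF p hp.1 q h.le) hq.2.1
    obtain ⟨u, hu, hup⟩ := exists_covBy_le_of_lt hlt
    have hadj := H.h3 q u hu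
    have : u ≠ p := by
      rintro rfl
      rw [hl, hp.2.1] at hadj
      exact H.irrefl _ hadj
    exact hp.2.2 u (hq.2.2 u hu.lt) (lt_of_le_of_ne hup this)

include H hF hFQ hmF hmin in
theorem T_lt {q : P} (hq : q ∈ F) (hl : lab q = lab m) : m < q := by
  rcases H.lt_or hl with h | h | h
  · exact absurd h (hmin q (hFQ hq))
  · exact absurd (h ▸ hq) hmF
  · exact h

/-- top `i`-element outside `F` -/
theorem T_top (lab : P → L) {Q F : Finset P} {m : P} (hm : m ∈ Q) (hmF : m ∉ F) :
    ∃ q ∈ Q, q ∉ F ∧ lab q = lab m ∧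
    ∀ r ∈ Q, q < r → lab r = lab m → r ∈ F := by
  obtain ⟨q, hq, hmax⟩ := ((Q \ F).filter (fun r => lab r = lab m)).exists_maximal ⟨m, by simp [hm, hmF]⟩
  simp only [Finset.mem_filter, Finset.mem_sdiff] at hq hmax
  refine ⟨q, hq.1.1, hq.1.2, hq.2, fun r hr hqr hl => ?_⟩
  by_contra hrF
  exact absurd (hmax (y := r) ⟨⟨hr, hrF⟩, hl⟩ hqr.le) hqr.not_ge

include H hQ hF hFQ hm hmF hmin in
theorem T2 {p : P} (hp : p ∈ Rem lab (lab m) F) :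
    cc lab Adj (lab m) (Q \ F) = 0 := by
  rw [mem_Rem] at hp
  obtain ⟨q, hq, hqF, hl, htop⟩ := T_top lab hm hmF
  have hqp : q < p := by
    rcases H.lt_or (hl.trans hp.2.1.symm) with h | h | h
    · exact h
    · exact absurd (h ▸ hp.1) hqF
    · exact absurd (hF p hp.1 q h.le) hqF
  have hcons : ∀ c, q < c → c < p → lab c ≠ lab q := fun c h1 h2 h3 =>
    hp.2.2 c (htop c (hQ q hq c h1.le) h1 (h3.trans hl)) h2
  rw [T_red H hQ hF hm hmin hq hqF hl]
  have hi := H.inter hqp (hl.trans hp.2.1.symm) hcons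
  have : cc lab Adj (lab m) ((Q \ F).filter (q < ·)) =
      cc lab Adj (lab m) (Finset.univ.filter (fun r => q < r ∧ r < p)) := by
    symm
    unfold cc
    apply Finset.sum_subset
    · intro r hr
      simp only [Finset.mem_filter, Finset.mem_univ, true_and, Finset.mem_sdiff] at hr ⊢
      exact ⟨⟨hQ q hq r hr.1.le, fun h => hp.2.2 r h hr.2⟩, hr.1⟩
    · intro r hr hr2
      simp only [Finset.mem_filter, Finset.mem_univ, true_and, Finset.mem_sdiff] at hr hr2
      by_contra h0
      rw [← hp.2.1] at h0
      rcases H.cmp h0 with h | h | h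
      · exact hr2 ⟨hr.2, h⟩
      · exact hr.1.2 (h ▸ hp.1)
      · exact hr.1.2 (hF p hp.1 r h.le)
  rw [this, ← hl, hi]; rfl

include H hQ hF hFQ hm hmF hmin in
theorem T2' {p : P} (hp : p ∈ Rem lab (lab m) F) {q : P} (hq : q ∈ addable Q F) : lab q ≠ lab m := by
  intro hl
  have := (T0 H hQ hF hm hmin hq hl).2
  rw [this] at hp
  simp at hp

include H hQ hF hFQ hm hmF hmin in
theorem T1 (h1 : Rem lab (lab m) F = ∅) (h2 : ∀ q ∈ addable Q F, lab q ≠ lab m) :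
    cc lab Adj (lab m) (Q \ F) = 1 := by
  obtain ⟨q, hq, hqF, hl, htop⟩ := T_top lab hm hmF
  rw [T_red H hQ hF hm hmin hq hqF hl]
  have hna : q ∉ addable Q F := fun h => h2 q h hl
  rw [mem_addable] at hna
  push Not at hna
  obtain ⟨r, hqr, hrF⟩ := hna hq hqF
  obtain ⟨u, hu, hur⟩ := exists_covBy_le_of_lt hqr
  have huF : u ∉ F := fun h => hrF (hF u h r hur)
  have hadj := H.h3 q u hu
  rw [cc_eq_neg_card]
  swap
  · intro r hr h
    simp only [Finset.mem_filter, Finset.mem_sdiff] at hr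
    exact hr.1.2 (htop r hr.1.1 hr.2 h)
  rw [Finset.filter_filter]
  have hpos : 0 < ((Q \ F).filter (fun r => q < r ∧ Adj (lab m) (lab r))).card := by
    apply Finset.card_pos.2
    refine ⟨u, ?_⟩
    simp only [Finset.mem_filter, Finset.mem_sdiff]
    exact ⟨⟨hQ q hq u hu.le, huF⟩, hu.lt, hl ▸ hadj⟩
  have hle : ((Q \ F).filter (fun r => q < r ∧ Adj (lab m) (lab r))).card < 2 := by
    by_cases hex : ∃ b, q < b ∧ lab b = lab q
    · obtain ⟨b, hb, hlb⟩ := hex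
      obtain ⟨a, hqa, -, hla, hc⟩ := exists_succ hb hlb.symm
      have haF : a ∈ F := htop a (hQ q hq a hqa.le) hqa (hla.trans hl)
      have haR : a ∉ Rem lab (lab m) F := by rw [h1]; simp
      rw [mem_Rem] at haR
      push Not at haR
      obtain ⟨s, hsF, hsa⟩ := haR haF (hla.trans hl)
      obtain ⟨v, hsv, hv⟩ := exists_le_covBy_of_lt hsa
      have hvF : v ∈ F := hF s hsF v hsv
      have hadjv := H.symm _ _ (H.h3 v a hv)
      rw [hla] at hadjv
      have hqv : q < v := by
        rcases H.lt_or' hadjv with h | h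
        · exact h
        · exact absurd (hF v hvF q h.le) hqF
      rw [← H.h4 q a hqa hla.symm hc]
      apply Finset.card_lt_card
      rw [Finset.ssubset_iff_of_subset]
      · refine ⟨v, by simp [hqv, hv.lt, hadjv], by simp [hvF]⟩
      · intro r hr
        simp only [Finset.mem_filter, Finset.mem_univ, true_and, Finset.mem_sdiff] at hr ⊢
        have hra : Adj (lab a) (lab r) := by rw [hla, hl]; exact hr.2.2
        refine ⟨hr.2.1, ?_, hl ▸ hr.2.2⟩
        rcases H.lt_or' hra with h | h
        · exact absurd (hF a haF r h.le) hr.1.2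
        · exact h
    · push Not at hex
      have := H.h5 q hex
      refine lt_of_le_of_lt (le_trans (Finset.card_le_card ?_) this) (by norm_num)
      intro r hr
      simp only [Finset.mem_filter, Finset.mem_univ, true_and, Finset.mem_sdiff] at hr ⊢
      exact ⟨hr.2.1, hl ▸ hr.2.2⟩
  omega

end T
end HeapPartB

noncomputable section HeapPartC

variable {P L : Type*} [PartialOrder P] [Fintype P] {lab : P → L} {Adj : L → L → Prop}

def sr (Adj : L → L → Prop) (i : L) : MvPolynomial L ℚ →ₐ[ℚ] MvPolynomial L ℚ :=
  MvPolynomial.aeval (fun j => MvPolynomial.X j - (ca Adj i j : MvPolynomial L ℚ) * MvPolynomial.X i)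

def xs (lab : P → L) (A : Finset P) : MvPolynomial L ℚ := ∑ r ∈ A, MvPolynomial.X (lab r)

theorem sr_X (i j : L) : sr Adj i (MvPolynomial.X j) =
    MvPolynomial.X j - (ca Adj i j : MvPolynomial L ℚ) * MvPolynomial.X i := by
  simp [sr]

theorem sr_xs (i : L) (A : Finset P) : sr Adj i (xs lab A) =
    xs lab A - (cc lab Adj i A : MvPolynomial L ℚ) * MvPolynomial.X i := by
  unfold xs cc
  rw [map_sum]
  simp only [sr_X]
  rw [Finset.sum_sub_distrib, Int.cast_sum, Finset.sum_mul]

def RecG (lab : P → L) (Q : Finset P) (G : Finset P → MvPolynomial L ℚ) : Prop :=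
  ∀ F, Up F → F ⊆ Q → xs lab (Q \ F) * G F = ∑ p ∈ addable Q F, G (insert p F)

def stepG (lab : P → L) (Adj : L → L → Prop) (m : P) (G : Finset P → MvPolynomial L ℚ)
    (F : Finset P) : MvPolynomial L ℚ :=
  (if m ∈ F then 0 else sr Adj (lab m) (G F)) +
    MvPolynomial.X (lab m) * ∑ q ∈ Rem lab (lab m) F, sr Adj (lab m) (G (F.erase q))

section S
variable (H : HeapAx lab Adj) {Q F : Finset P} (hQ : Up Q) (hF : Up F) (hFQ : F ⊆ Q) {m : P}
  (hm : m ∈ Q) (hmin : ∀ r ∈ Q, ¬ r < m) {G : Finset P → MvPolynomial L ℚ}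

include hF in
theorem up_erase {q : P} (hmin : ∀ r ∈ F, ¬ r < q) : Up (F.erase q) := by
  intro a ha b hab
  rw [Finset.mem_erase] at ha ⊢
  refine ⟨?_, hF a ha.2 b hab⟩
  rintro rfl
  exact hmin a ha.2 (lt_of_le_of_ne hab ha.1)

include H hFQ hm hmin in
theorem Rem_eq_m (hmF : m ∈ F) : Rem lab (lab m) F = {m} := by
  ext q
  rw [mem_Rem, Finset.mem_singleton]
  constructor
  · rintro ⟨h1, h2, h3⟩
    rcases H.lt_or h2 with h | h | h
    · exact absurd h (hmin q (hFQ h1))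
    · exact h
    · exact absurd h (h3 m hmF)
  · rintro rfl
    exact ⟨hmF, rfl, fun r hr => hmin r (hFQ hr)⟩

include H hQ hF hFQ hm hmin in
theorem step_mem (hG : RecG lab (Q.erase m) G) (hmF : m ∈ F) :
    xs lab (Q \ F) * stepG lab Adj m G F = ∑ p ∈ addable Q F, stepG lab Adj m G (insert p F) := by
  have hA : addable Q F = addable (Q.erase m) (F.erase m) := by
    ext p
    simp only [mem_addable, Finset.mem_erase]
    constructor
    · rintro ⟨h1, h2, h3⟩
      refine ⟨⟨fun h => h2 (h ▸ hmF), h1⟩, fun h => h2 h.2, fun r hr => ⟨?_, h3 r hr⟩⟩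
      rintro rfl
      exact hmin p h1 hr
    · rintro ⟨⟨h1, h2⟩, h3, h4⟩
      exact ⟨h2, fun h => h3 ⟨h1, h⟩, fun r hr => (h4 r hr).2⟩
  have hsd : Q \ F = Q.erase m \ F.erase m := by
    ext p; simp only [Finset.mem_sdiff, Finset.mem_erase]
    constructor
    · rintro ⟨h1, h2⟩
      exact ⟨⟨fun h => h2 (h ▸ hmF), h1⟩, fun h => h2 h.2⟩
    · rintro ⟨⟨h1, h2⟩, h3⟩
      exact ⟨h2, fun h => h3 ⟨h1, h⟩⟩
  have hc : cc lab Adj (lab m) (Q \ F) = 0 := by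
    unfold cc
    apply Finset.sum_eq_zero
    intro r hr
    rw [Finset.mem_sdiff] at hr
    by_contra h0
    rcases H.cmp h0 with h | h | h
    · exact hmin r hr.1 h
    · exact hr.2 (h ▸ hmF)
    · exact hr.2 (hF m hmF r h.le)
  have hsx := sr_xs (lab := lab) (Adj := Adj) (lab m) (Q \ F)
  rw [hc] at hsx
  simp only [Int.cast_zero, zero_mul, sub_zero] at hsx
  have hr := hG (F.erase m) (up_erase hF (fun r hr => hmin r (hFQ hr)))
    (Finset.erase_subset_erase m hFQ)
  rw [← hA, ← hsd] at hr
  have hr' := congrArg (sr Adj (lab m)) hr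
  rw [map_mul, hsx, map_sum] at hr'
  have hterm : ∀ p ∈ addable Q F, stepG lab Adj m G (insert p F) =
      MvPolynomial.X (lab m) * sr Adj (lab m) (G (insert p (F.erase m))) := by
    intro p hp
    rw [mem_addable] at hp
    have hpm : p ≠ m := fun h => hp.2.1 (h ▸ hmF)
    have hsub : insert p F ⊆ Q := Finset.insert_subset hp.1 hFQ
    unfold stepG
    rw [Rem_eq_m H hsub hm hmin (by simp [hmF]), if_pos (by simp [hmF]), zero_add,
      Finset.sum_singleton, Finset.erase_insert_of_ne hpm]
  rw [Finset.sum_congr rfl hterm, ← Finset.mul_sum, ← hr']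
  unfold stepG
  rw [Rem_eq_m H hFQ hm hmin hmF, if_pos hmF, zero_add, Finset.sum_singleton]
  ring

include H hQ hF hFQ hm hmin in
theorem step_not_mem (hG : RecG lab (Q.erase m) G) (hmF : m ∉ F) :
    xs lab (Q \ F) * stepG lab Adj m G F = ∑ p ∈ addable Q F, stepG lab Adj m G (insert p F) := by
  have hA : addable (Q.erase m) F = (addable Q F).erase m := by
    ext p
    simp only [mem_addable, Finset.mem_erase]
    tauto
  have hFQ' : F ⊆ Q.erase m := fun x hx => Finset.mem_erase.2 ⟨fun h => hmF (h ▸ hx), hFQ hx⟩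
  have hsd : Q \ F = insert m (Q.erase m \ F) := by
    ext p; simp only [Finset.mem_sdiff, Finset.mem_erase, Finset.mem_insert]
    by_cases h : p = m
    · subst h; simp [hm, hmF]
    · simp [h]
  have hmn : m ∉ Q.erase m \ F := by simp
  have hx : xs lab (Q \ F) = MvPolynomial.X (lab m) + xs lab (Q.erase m \ F) := by
    rw [hsd]; unfold xs; rw [Finset.sum_insert hmn]
  have hc : cc lab Adj (lab m) (Q \ F) = 2 + cc lab Adj (lab m) (Q.erase m \ F) := by
    rw [hsd]; unfold cc; rw [Finset.sum_insert hmn, ca_self]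
  have hsx := sr_xs (lab := lab) (Adj := Adj) (lab m) (Q.erase m \ F)
  have hxx : sr Adj (lab m) (xs lab (Q.erase m \ F)) = xs lab (Q \ F) -
      ((cc lab Adj (lab m) (Q \ F) : MvPolynomial L ℚ) - 1) * MvPolynomial.X (lab m) := by
    rw [hsx, hx, hc]; push_cast; ring
  have hr := congrArg (sr Adj (lab m)) (hG F hF hFQ')
  rw [map_mul, hxx, map_sum] at hr
  -- first part of the sum
  have h1 : ∑ p ∈ addable Q F, (if m ∈ insert p F then 0 else sr Adj (lab m) (G (insert p F))) =
      ∑ p ∈ addable (Q.erase m) F, sr Adj (lab m) (G (insert p F)) := by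
    rw [hA]
    symm
    rw [Finset.sum_congr rfl (g := fun p => (if m ∈ insert p F then 0
      else sr Adj (lab m) (G (insert p F))))]
    · apply Finset.sum_subset (Finset.erase_subset _ _)
      intro x hx hx2
      rw [Finset.mem_erase] at hx2
      have : x = m := by
        by_contra h; exact hx2 ⟨h, hx⟩
      simp [this]
    · intro x hx
      rw [Finset.mem_erase] at hx
      rw [if_neg]
      simp [hmF, Ne.symm hx.1]
  have hsum : ∑ p ∈ addable Q F, stepG lab Adj m G (insert p F) =
      (xs lab (Q \ F) - ((cc lab Adj (lab m) (Q \ F) : MvPolynomial L ℚ) - 1)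
          * MvPolynomial.X (lab m)) * sr Adj (lab m) (G F)
      + MvPolynomial.X (lab m) * ∑ p ∈ addable Q F, ∑ q ∈ Rem lab (lab m) (insert p F),
        sr Adj (lab m) (G ((insert p F).erase q)) := by
    unfold stepG
    rw [Finset.sum_add_distrib, h1, ← hr, Finset.mul_sum]
  rw [hsum]
  unfold stepG
  rw [if_neg hmF]
  have hremins : ∀ p ∈ addable Q F, ∀ q ∈ Rem lab (lab m) (insert p F), q ≠ p →
      q ∈ Rem lab (lab m) F := by
    intro p hp q hq hqp
    rw [mem_Rem] at hq ⊢
    refine ⟨?_, hq.2.1, fun r hr => hq.2.2 r (Finset.mem_insert_of_mem hr)⟩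
    exact (Finset.mem_insert.1 hq.1).resolve_left hqp
  by_cases hadd : ∃ q ∈ addable Q F, lab q = lab m
  · obtain ⟨q, hq, hl⟩ := hadd
    obtain ⟨hc2, hR⟩ := T0 H hQ hF hm hmin hq hl
    have hE : ∑ p ∈ addable Q F, ∑ q ∈ Rem lab (lab m) (insert p F),
        sr Adj (lab m) (G ((insert p F).erase q)) = sr Adj (lab m) (G F) := by
      rw [Finset.sum_eq_single_of_mem q hq]
      · have hq' := mem_addable.1 hq
        have : Rem lab (lab m) (insert q F) = {q} := by
          ext p
          rw [Finset.mem_singleton]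
          constructor
          · intro hp
            by_contra hpq
            have := hremins q hq p hp hpq
            rw [hR] at this
            simp at this
          · rintro rfl
            rw [mem_Rem]
            refine ⟨by simp, hl, fun r hr hrp => ?_⟩
            rcases Finset.mem_insert.1 hr with h | h
            · exact hrp.ne h
            · exact hq'.2.1 (hF r h p hrp.le)
        rw [this, Finset.sum_singleton, Finset.erase_insert hq'.2.1]
      · intro p hp hpq
        apply Finset.sum_eq_zero
        intro r hr
        exfalso
        by_cases hrp : r = p
        · subst hrp
          have hl2 := (mem_Rem.1 hr).2.1
          have hp' := mem_addable.1 hp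
          have hq' := mem_addable.1 hq
          rcases H.lt_or (hl2.trans hl.symm) with h | h | h
          · exact hq'.2.1 (hp'.2.2 q h)
          · exact hpq h
          · exact hp'.2.1 (hq'.2.2 r h)
        · have := hremins p hp r hr hrp
          rw [hR] at this
          simp at this
    rw [hE, hc2, hR]
    simp only [Finset.sum_empty, Int.cast_ofNat]
    ring
  · push Not at hadd
    by_cases hR : Rem lab (lab m) F = ∅
    · have hc1 := T1 H hQ hF hFQ hm hmF hmin hR hadd
      have hE : ∑ p ∈ addable Q F, ∑ q ∈ Rem lab (lab m) (insert p F),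
          sr Adj (lab m) (G ((insert p F).erase q)) = 0 := by
        apply Finset.sum_eq_zero
        intro p hp
        apply Finset.sum_eq_zero
        intro r hr
        exfalso
        by_cases hrp : r = p
        · subst hrp
          exact hadd r hp (mem_Rem.1 hr).2.1
        · have := hremins p hp r hr hrp
          rw [hR] at this
          simp at this
      rw [hE, hc1, hR]
      simp
    · obtain ⟨q, hq⟩ := Finset.nonempty_iff_ne_empty.2 hR
      have hc0 := T2 H hQ hF hFQ hm hmF hmin hq
      have hq' := mem_Rem.1 hq
      have hmq : m < q := T_lt H hF hFQ hmF hmin hq'.1 hq'.2.1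
      have hRq : Rem lab (lab m) F = {q} := by
        ext p
        rw [Finset.mem_singleton]
        constructor
        · intro hp
          have hp' := mem_Rem.1 hp
          rcases H.lt_or (hp'.2.1.trans hq'.2.1.symm) with h | h | h
          · exact absurd h (hq'.2.2 p hp'.1)
          · exact h
          · exact absurd h (hp'.2.2 q hq'.1)
        · rintro rfl; exact hq
      have hUe := up_erase hF hq'.2.2
      have hA2 : addable (Q.erase m) (F.erase q) =
          insert q ((addable Q F).filter (fun p => ¬ p < q)) := by
        ext p
        simp only [mem_addable, Finset.mem_insert, Finset.mem_filter, Finset.mem_erase]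
        constructor
        · rintro ⟨⟨h1, h2⟩, h3, h4⟩
          by_cases hpq : p = q
          · exact Or.inl hpq
          · refine Or.inr ⟨⟨h2, fun h => h3 ⟨hpq, h⟩, fun r hr => (h4 r hr).2⟩, fun h => ?_⟩
            exact (h4 q h).1 rfl
        · rintro (rfl | ⟨⟨h1, h2, h3⟩, h4⟩)
          · exact ⟨⟨hmq.ne', hFQ hq'.1⟩, fun h => h.1 rfl, fun r hr => ⟨hr.ne', hF _ hq'.1 r hr.le⟩⟩
          · refine ⟨⟨?_, h1⟩, fun h => h2 h.2, fun r hr => ⟨?_, h3 r hr⟩⟩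
            · rintro rfl; exact h4 hmq
            · rintro rfl; exact h4 hr
      have hnq : q ∉ (addable Q F).filter (fun p => ¬ p < q) := by
        simp only [Finset.mem_filter, mem_addable]
        exact fun h => h.1.2.1 hq'.1
      have hsd2 : Q.erase m \ F.erase q = insert q (Q.erase m \ F) := by
        ext p; simp only [Finset.mem_sdiff, Finset.mem_erase, Finset.mem_insert]
        by_cases h : p = q
        · subst h; simp [hmq.ne', hFQ hq'.1]
        · simp [h]
      have hx2 : sr Adj (lab m) (xs lab (Q.erase m \ F.erase q)) = xs lab (Q \ F) := by
        have : xs lab (insert q (Q.erase m \ F)) = MvPolynomial.X (lab m) + xs lab (Q.erase m \ F) := by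
          unfold xs; rw [Finset.sum_insert (by simp [hq'.1]), hq'.2.1]
        rw [hsd2, this, map_add, hxx, sr_X, ca_self, hc0]
        push_cast; ring
      have hr2 := congrArg (sr Adj (lab m)) (hG (F.erase q) hUe
        ((Finset.erase_subset _ _).trans hFQ'))
      rw [map_mul, hx2, map_sum, hA2, Finset.sum_insert hnq, Finset.insert_erase hq'.1] at hr2
      have hE : ∑ p ∈ addable Q F, ∑ q ∈ Rem lab (lab m) (insert p F),
          sr Adj (lab m) (G ((insert p F).erase q)) =
          ∑ p ∈ (addable Q F).filter (fun p => ¬ p < q),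
            sr Adj (lab m) (G (insert p (F.erase q))) := by
        rw [Finset.sum_filter]
        refine Finset.sum_congr rfl fun p hp => ?_
        have hp' := mem_addable.1 hp
        have hpq : p ≠ q := fun h => hp'.2.1 (h ▸ hq'.1)
        have hsubs : ∀ r ∈ Rem lab (lab m) (insert p F), r = q := by
          intro r hr
          by_cases hrp : r = p
          · subst hrp
            exact absurd (mem_Rem.1 hr).2.1 (hadd r hp)
          · have := hremins p hp r hr hrp
            rw [hRq] at this
            simpa using this
        split_ifs with hlt
        · apply Finset.sum_eq_zero
          intro r hr
          have := hsubs r hr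
          subst this
          exact absurd hlt ((mem_Rem.1 hr).2.2 p (by simp))
        · have : Rem lab (lab m) (insert p F) = {q} := by
            ext r
            rw [Finset.mem_singleton]
            refine ⟨hsubs r, ?_⟩
            rintro rfl
            rw [mem_Rem]
            refine ⟨by simp [hq'.1], hq'.2.1, fun s hs => ?_⟩
            rcases Finset.mem_insert.1 hs with h | h
            · rw [h]; exact hlt
            · exact hq'.2.2 s h
          rw [this, Finset.sum_singleton, Finset.erase_insert_of_ne hpq]
      rw [hE, hRq, Finset.sum_singleton, hc0]
      have : ∑ p ∈ (addable Q F).filter (fun p => ¬ p < q),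
            sr Adj (lab m) (G (insert p (F.erase q))) = xs lab (Q \ F) * sr Adj (lab m) (G (F.erase q))
              - sr Adj (lab m) (G F) := by
        rw [hr2]; ring
      rw [this]
      push_cast; ring

include H hQ hm hmin in
theorem step_rec (hG : RecG lab (Q.erase m) G) : RecG lab Q (stepG lab Adj m G) := by
  intro F hF hFQ
  by_cases hmF : m ∈ F
  · exact step_mem H hQ hF hFQ hm hmin hG hmF
  · exact step_not_mem H hQ hF hFQ hm hmin hG hmF

end S

structure BigInv (lab : P → L) (Adj : L → L → Prop) (Q : Finset P)
    (G : Finset P → MvPolynomial L ℚ) (β : P → MvPolynomial L ℚ) : Prop where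
  g0 : G ∅ = 1
  recG : RecG lab Q G
  gQ : G Q = ∏ p ∈ Q, β p
  b1 : ∀ a ∈ Q, ∀ b, a < b → lab a = lab b → (∀ c, a < c → c < b → lab c ≠ lab a) →
    β b = ∑ r ∈ Finset.univ.filter (fun r => a < r ∧ r < b ∧ Adj (lab a) (lab r)), β r - β a
  b1' : ∀ b ∈ Q, (∀ a ∈ Q, a < b → lab a ≠ lab b) →
    β b = MvPolynomial.X (lab b) + ∑ r ∈ Q.filter (fun r => r < b ∧ Adj (lab b) (lab r)), β r
  b2 : ∀ b ∈ Q, (∀ a, a < b → lab a ≠ lab b) →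
    β b = xs lab (Q.filter (· ≤ b)) ∧ qf lab Adj (Q.filter (· ≤ b)) = 2

theorem big_step (H : HeapAx lab Adj) {Q : Finset P} (hQ : Up Q) {m : P}
    (hm : m ∈ Q) (hmin : ∀ r ∈ Q, ¬ r < m) {G : Finset P → MvPolynomial L ℚ}
    {β : P → MvPolynomial L ℚ} (hI : BigInv lab Adj (Q.erase m) G β) :
    BigInv lab Adj Q (stepG lab Adj m G)
      (fun p => if p = m then MvPolynomial.X (lab m) else sr Adj (lab m) (β p)) := by
  refine ⟨?_, step_rec H hQ hm hmin hI.recG, ?_, ?_, ?_, ?_⟩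
  · simp [stepG, Rem, hI.g0]
  · unfold stepG
    rw [if_pos hm, Rem_eq_m H subset_rfl hm hmin hm, zero_add, Finset.sum_singleton, hI.gQ,
      ← Finset.mul_prod_erase Q _ hm, if_pos rfl, map_prod]
    congr 1
    refine Finset.prod_congr rfl fun p hp => ?_
    rw [if_neg (Finset.ne_of_mem_erase hp)]
  · intro a ha b hab hl hc
    have hbm : b ≠ m := by rintro rfl; exact hmin a ha hab
    rw [if_neg hbm]
    have hS : ∑ r ∈ Finset.univ.filter (fun r => a < r ∧ r < b ∧ Adj (lab a) (lab r)),
        (if r = m then MvPolynomial.X (lab m) else sr Adj (lab m) (β r)) =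
        sr Adj (lab m) (∑ r ∈ Finset.univ.filter (fun r => a < r ∧ r < b ∧ Adj (lab a) (lab r)), β r) := by
      rw [map_sum]
      refine Finset.sum_congr rfl fun r hr => ?_
      rw [if_neg]
      rintro rfl
      simp only [Finset.mem_filter] at hr
      exact hmin a ha hr.2.1
    rw [hS]
    by_cases ham : a = m
    · subst ham
      rw [if_pos rfl, hI.b1' b (Finset.mem_erase.2 ⟨hbm, hQ a ha b hab.le⟩), ← hl, map_add, sr_X, ca_self]
      · have : (Q.erase a).filter (fun r => r < b ∧ Adj (lab a) (lab r)) =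
            Finset.univ.filter (fun r => a < r ∧ r < b ∧ Adj (lab a) (lab r)) := by
          ext r
          simp only [Finset.mem_filter, Finset.mem_univ, true_and, Finset.mem_erase]
          constructor
          · rintro ⟨⟨h1, h2⟩, h3, h4⟩
            refine ⟨?_, h3, h4⟩
            rcases H.lt_or' h4 with h | h
            · exact h
            · exact absurd h (hmin r h2)
          · rintro ⟨h1, h2, h3⟩
            exact ⟨⟨h1.ne', hQ a ha r h1.le⟩, h2, h3⟩
        rw [this]
        push_cast; ring
      · intro c hcQ hcb hlc
        rw [Finset.mem_erase] at hcQ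
        rcases H.lt_or (hlc.trans hl.symm) with h | h | h
        · exact hmin c hcQ.2 h
        · exact hcQ.1 h
        · exact hc c h hcb (hlc.trans hl.symm)
    · rw [if_neg ham, ← map_sub, ← hI.b1 a (Finset.mem_erase.2 ⟨ham, ha⟩) b hab hl hc]
  · intro b hb hno
    by_cases hbm : b = m
    · subst hbm
      rw [if_pos rfl]
      have : Q.filter (fun r => r < b ∧ Adj (lab b) (lab r)) = ∅ := by
        rw [Finset.filter_eq_empty_iff]
        intro r hr h
        exact hmin r hr h.1
      rw [this]; simp
    · rw [if_neg hbm, hI.b1' b (Finset.mem_erase.2 ⟨hbm, hb⟩)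
        (fun a ha => hno a (Finset.mem_of_mem_erase ha)), map_add, sr_X, map_sum]
      have hlb : lab m ≠ lab b := by
        intro hl
        rcases H.lt_or hl with h | h | h
        · exact hno m hm h hl
        · exact hbm h.symm
        · exact hmin b hb h
      have hs : ∑ r ∈ (Q.erase m).filter (fun r => r < b ∧ Adj (lab b) (lab r)), sr Adj (lab m) (β r) =
          ∑ r ∈ (Q.erase m).filter (fun r => r < b ∧ Adj (lab b) (lab r)),
            (if r = m then MvPolynomial.X (lab m) else sr Adj (lab m) (β r)) := by
        refine Finset.sum_congr rfl fun r hr => ?_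
        rw [if_neg]
        simp only [Finset.mem_filter] at hr
        exact Finset.ne_of_mem_erase hr.1
      rw [hs]
      by_cases hadj : Adj (lab b) (lab m)
      · have hmb : m < b := by
          rcases H.lt_or' hadj with h | h
          · exact absurd h (hmin b hb)
          · exact h
        have : Q.filter (fun r => r < b ∧ Adj (lab b) (lab r)) =
            insert m ((Q.erase m).filter (fun r => r < b ∧ Adj (lab b) (lab r))) := by
          ext r
          simp only [Finset.mem_filter, Finset.mem_erase, Finset.mem_insert]
          by_cases h : r = m
          · subst h; simp [hm, hmb, hadj]
          · simp [h]
        rw [this, Finset.sum_insert (by simp), if_pos rfl]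
        have : ca Adj (lab m) (lab b) = -1 := by
          unfold ca; rw [if_neg hlb, if_pos (H.symm _ _ hadj)]
        rw [this]; push_cast; ring
      · have : Q.filter (fun r => r < b ∧ Adj (lab b) (lab r)) =
            (Q.erase m).filter (fun r => r < b ∧ Adj (lab b) (lab r)) := by
          ext r
          simp only [Finset.mem_filter, Finset.mem_erase]
          by_cases h : r = m
          · subst h; simp [hadj]
          · simp [h]
        rw [this]
        have : ca Adj (lab m) (lab b) = 0 := by
          unfold ca; rw [if_neg hlb, if_neg (fun h => hadj (H.symm _ _ h))]
        rw [this]; push_cast; ring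
  · intro b hb hno
    by_cases hbm : b = m
    · subst hbm
      have : Q.filter (· ≤ b) = {b} := by
        ext r
        simp only [Finset.mem_filter, Finset.mem_singleton]
        constructor
        · rintro ⟨h1, h2⟩
          by_contra h
          exact hmin r h1 (lt_of_le_of_ne h2 h)
        · rintro rfl; exact ⟨hb, le_rfl⟩
      rw [this]
      simp [xs, qf, cc, ca_self]
    · obtain ⟨h1, h2⟩ := hI.b2 b (Finset.mem_erase.2 ⟨hbm, hb⟩) hno
      rw [if_neg hbm, h1, sr_xs]
      by_cases hmb : m < b
      · have hQe : Q.filter (· ≤ b) = insert m ((Q.erase m).filter (· ≤ b)) := by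
          ext r
          simp only [Finset.mem_filter, Finset.mem_erase, Finset.mem_insert]
          by_cases h : r = m
          · subst h; simp [hm, hmb.le]
          · simp [h]
        have hni : m ∉ (Q.erase m).filter (· ≤ b) := by simp
        have hc2 : cc lab Adj (lab m) (Q.filter (· ≤ b)) =
            2 + cc lab Adj (lab m) ((Q.erase m).filter (· ≤ b)) := by
          rw [hQe]; unfold cc; rw [Finset.sum_insert hni, ca_self]
        have hqi := H.qf_insert _ m hni
        rw [← hQe, h2] at hqi
        have hpos := H.qf_pos _ (Q.filter (· ≤ b)) ⟨b, by simp [hb]⟩ rfl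
        -- upper bound for the count
        have hle : cc lab Adj (lab m) (Q.filter (· ≤ b)) ≤ 1 := by
          obtain ⟨q, hq, hmax⟩ := (Q.filter (fun r => r ≤ b ∧ lab r = lab m)).exists_maximal
            ⟨m, by simp [hm, hmb.le]⟩
          simp only [Finset.mem_filter] at hq hmax
          have hqb : q < b := by
            refine lt_of_le_of_ne hq.2.1 ?_
            rintro rfl
            exact hno m hmb hq.2.2.symm
          rw [H.red Q _ hQ hm hmin (Finset.filter_subset _ _) (q := q) _ (by simp [hq.1, hq.2.1]) hq.2.2]
          · rw [cc_eq_neg_card]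
            · obtain ⟨u, hu, hub⟩ := exists_covBy_le_of_lt hqb
              have : 0 < (((Q.filter (· ≤ b)).filter (q < ·)).filter
                  (fun r => Adj (lab m) (lab r))).card := by
                apply Finset.card_pos.2
                refine ⟨u, ?_⟩
                simp only [Finset.mem_filter]
                exact ⟨⟨⟨hQ q hq.1 u hu.le, hub⟩, hu.lt⟩, hq.2.2 ▸ H.h3 q u hu⟩
              omega
            · intro r hr hlr
              simp only [Finset.mem_filter] at hr
              exact absurd (hmax (y := r) ⟨hr.1.1, hr.1.2, hlr⟩ hr.2.le) hr.2.not_ge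
          · intro x hx y hy hyx
            simp only [Finset.mem_filter] at hx ⊢
            exact ⟨hy, hyx.trans hx.2⟩
        have hcm : cc lab Adj (lab m) ((Q.erase m).filter (· ≤ b)) = -1 := by omega
        rw [hcm] at hqi ⊢
        refine ⟨?_, by omega⟩
        have : xs lab (Q.filter (· ≤ b)) = MvPolynomial.X (lab m) + xs lab ((Q.erase m).filter (· ≤ b)) := by
          rw [hQe]; unfold xs; rw [Finset.sum_insert hni]
        rw [this]; push_cast; ring
      · have hQe : Q.filter (· ≤ b) = (Q.erase m).filter (· ≤ b) := by
          ext r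
          simp only [Finset.mem_filter, Finset.mem_erase]
          by_cases h : r = m
          · subst h
            simp only [ne_eq, not_true_eq_false, false_and, iff_false, not_and]
            exact fun _ h => hmb (lt_of_le_of_ne h (Ne.symm hbm))
          · simp [h]
        have hc0 : cc lab Adj (lab m) ((Q.erase m).filter (· ≤ b)) = 0 := by
          unfold cc
          apply Finset.sum_eq_zero
          intro r hr
          simp only [Finset.mem_filter, Finset.mem_erase] at hr
          by_contra h0
          rcases H.cmp h0 with h | h | h
          · exact hmin r hr.1.2 h
          · exact hr.1.1 h
          · exact hmb (h.trans_le hr.2)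
        rw [hQe, hc0]
        refine ⟨by simp, h2⟩

theorem big_exists (H : HeapAx lab Adj) (n : ℕ) : ∀ Q : Finset P, Q.card = n → Up Q →
    ∃ G β, BigInv lab Adj Q G β := by
  induction n with
  | zero =>
    intro Q hc hQ
    rw [Finset.card_eq_zero] at hc
    subst hc
    refine ⟨fun _ => 1, fun _ => 1, rfl, ?_, by simp, by simp, by simp, by simp⟩
    intro F _ hF
    simp [xs, addable]
  | succ n ih =>
    intro Q hc hQ
    obtain ⟨m, hm, hmin⟩ := Q.exists_minimal (Finset.card_pos.1 (by omega))
    have hmin' : ∀ r ∈ Q, ¬ r < m := fun r hr h => h.not_ge (hmin hr h.le)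
    obtain ⟨G, β, hI⟩ := ih (Q.erase m) (by rw [Finset.card_erase_of_mem hm]; omega)
      (up_erase hQ hmin')
    exact ⟨_, _, big_step H hQ hm hmin' hI⟩

end HeapPartC

noncomputable section HeapPartD

variable {P : Type*} [PartialOrder P] [Fintype P]

def Good {n : ℕ} (S : Finset P) (e : Fin n → P) : Prop :=
  Function.Injective e ∧ (∀ i, e i ∈ S) ∧ ∀ i j, e i < e j → j < i

def wt {K : Type*} [Field K] (x : P → K) {n : ℕ} (e : Fin n → P) : K :=
  (∏ i : Fin n, ∑ j ∈ Finset.univ.filter (fun j => i ≤ j), x (e j))⁻¹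

theorem Good.sum {n : ℕ} {S : Finset P} {e : Fin n → P} (h : Good S e) (hc : S.card = n)
    {K : Type*} [Field K] (x : P → K) : ∑ j, x (e j) = ∑ r ∈ S, x r := by
  have hi : Finset.univ.image e = S := by
    apply Finset.eq_of_subset_of_card_le
    · intro r hr
      obtain ⟨i, _, rfl⟩ := Finset.mem_image.1 hr
      exact h.2.1 i
    · rw [Finset.card_image_of_injective _ h.1, hc]; simp
  rw [← hi, Finset.sum_image (fun a _ b _ hab => h.1 hab)]

theorem Good.surj {n : ℕ} {S : Finset P} {e : Fin n → P} (h : Good S e) (hc : S.card = n)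
    {r : P} (hr : r ∈ S) : ∃ i, e i = r := by
  have hi : Finset.univ.image e = S := by
    apply Finset.eq_of_subset_of_card_le
    · intro r hr
      obtain ⟨i, _, rfl⟩ := Finset.mem_image.1 hr
      exact h.2.1 i
    · rw [Finset.card_image_of_injective _ h.1, hc]; simp
  rw [← hi] at hr
  obtain ⟨i, _, h⟩ := Finset.mem_image.1 hr
  exact ⟨i, h⟩

theorem good_cons {n : ℕ} {S : Finset P} (hc : S.card = n + 1) (p : P) (e : Fin n → P) :
    Good S (Fin.cons p e : Fin (n+1) → P) ↔
      (p ∈ S ∧ ∀ r ∈ S, ¬ p < r) ∧ Good (S.erase p) e := by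
  constructor
  · intro h
    have h0 : p ∈ S := by simpa using h.2.1 0
    refine ⟨⟨h0, ?_⟩, ?_, ?_, ?_⟩
    · intro r hr hpr
      obtain ⟨i, rfl⟩ := h.surj hc hr
      have := h.2.2 0 i (by simpa using hpr)
      simp at this
    · intro i j hij
      have := h.1 (a₁ := i.succ) (a₂ := j.succ) (by simpa using hij)
      simpa using this
    · intro i
      rw [Finset.mem_erase]
      refine ⟨fun hi => ?_, by simpa using h.2.1 i.succ⟩
      have := h.1 (a₁ := i.succ) (a₂ := 0) (by simpa using hi)
      exact Fin.succ_ne_zero _ this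
    · intro i j hij
      have := h.2.2 i.succ j.succ (by simpa using hij)
      simpa using this
  · rintro ⟨⟨h0, hmax⟩, h1, h2, h3⟩
    refine ⟨?_, ?_, ?_⟩
    · rw [Fin.cons_injective_iff]
      refine ⟨?_, h1⟩
      rintro ⟨i, hi⟩
      have := h2 i
      rw [hi] at this
      simp at this
    · intro i
      refine Fin.cases ?_ (fun i => ?_) i
      · simpa using h0
      · simpa using Finset.mem_of_mem_erase (h2 i)
    · intro i j
      refine Fin.cases ?_ (fun i => ?_) i <;> refine Fin.cases ?_ (fun j => ?_) j
      · simp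
      · intro h
        exact absurd h (by simpa using hmax _ (Finset.mem_of_mem_erase (h2 j)))
      · intro _
        exact Fin.succ_pos i
      · intro h
        have := h3 i j (by simpa using h)
        simpa using this

theorem wt_cons {K : Type*} [Field K] (x : P → K) {n : ℕ} (p : P) (e : Fin n → P) :
    wt x (Fin.cons p e : Fin (n+1) → P) =
      (∑ j, x ((Fin.cons p e : Fin (n+1) → P) j))⁻¹ * wt x e := by
  unfold wt
  rw [Fin.prod_univ_succ, mul_inv]
  congr 2
  · congr 1; simp
  · refine Finset.prod_congr rfl fun i _ => ?_
    rw [Finset.sum_filter, Finset.sum_filter, Fin.sum_univ_succ]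
    rw [if_neg (by simp), zero_add]
    simp only [Fin.cons_succ, Fin.succ_le_succ_iff]

theorem lin_sum {K : Type*} [Field K] (x : P → K) (f : Finset P → K)
    (hx : ∀ S : Finset P, S.Nonempty → ∑ r ∈ S, x r ≠ 0)
    (hf : ∀ F, Up F → (∑ r ∈ Finset.univ \ F, x r) * f F =
      ∑ p ∈ addable Finset.univ F, f (insert p F)) (n : ℕ) :
    ∀ F : Finset P, Up F → (Finset.univ \ F).card = n →
      (∑ e ∈ Finset.univ.filter (fun e : Fin n → P => Good (Finset.univ \ F) e), wt x e)
        * f Finset.univ = f F := by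
  induction n with
  | zero =>
    intro F hF hc
    rw [Finset.card_eq_zero, Finset.sdiff_eq_empty_iff_subset, Finset.univ_subset_iff] at hc
    subst hc
    have : Finset.univ.filter (fun e : Fin 0 → P => Good (Finset.univ \ Finset.univ) e) =
        Finset.univ := by
      rw [Finset.filter_eq_self]
      intro e _
      exact ⟨fun i => i.elim0, fun i => i.elim0, fun i => i.elim0⟩
    rw [this]
    simp [wt]
  | succ n ih =>
    intro F hF hc
    have hne : (Finset.univ \ F).Nonempty := Finset.card_pos.1 (by omega)
    have hx0 := hx _ hne
    have h1 : ∑ e ∈ Finset.univ.filter (fun e : Fin (n+1) → P => Good (Finset.univ \ F) e), wt x e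
        = ∑ p ∈ addable Finset.univ F, (∑ r ∈ Finset.univ \ F, x r)⁻¹ *
          ∑ e ∈ Finset.univ.filter (fun e : Fin n → P => Good (Finset.univ \ insert p F) e), wt x e := by
      rw [Finset.sum_filter, ← (Fin.consEquiv (fun _ : Fin (n+1) => P)).sum_comp,
        Fintype.sum_prod_type]
      have : addable Finset.univ F = Finset.univ.filter
          (fun p => p ∈ Finset.univ \ F ∧ ∀ r ∈ Finset.univ \ F, ¬ p < r) := by
        ext p
        simp only [mem_addable, Finset.mem_filter, Finset.mem_univ, true_and, Finset.mem_sdiff]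
        refine and_congr_right fun _ => forall_congr' fun r => ?_
        tauto
      rw [this, Finset.sum_filter]
      refine Finset.sum_congr rfl fun p _ => ?_
      have he : Finset.univ \ insert p F = (Finset.univ \ F).erase p := by
        ext r; simp
      rw [he]
      split_ifs with hp
      · rw [Finset.sum_filter, Finset.mul_sum]
        refine Finset.sum_congr rfl fun e _ => ?_
        change (if Good (Finset.univ \ F) (Fin.cons p e : Fin (n+1) → P) then
          wt x (Fin.cons p e : Fin (n+1) → P) else 0) = _
        by_cases hg : Good (Finset.univ \ F) (Fin.cons p e : Fin (n+1) → P)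
        · rw [if_pos hg, wt_cons, hg.sum hc, if_pos ((good_cons hc p e).1 hg).2]
        · rw [if_neg hg, if_neg, mul_zero]
          exact fun h => hg ((good_cons hc p e).2 ⟨hp, h⟩)
      · refine Finset.sum_eq_zero fun e _ => ?_
        change (if Good (Finset.univ \ F) (Fin.cons p e : Fin (n+1) → P) then
          wt x (Fin.cons p e : Fin (n+1) → P) else 0) = _
        rw [if_neg]
        exact fun h => hp ((good_cons hc p e).1 h).1
    rw [h1, Finset.sum_mul]
    have h2 : ∀ p ∈ addable Finset.univ F, ((∑ r ∈ Finset.univ \ F, x r)⁻¹ *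
          ∑ e ∈ Finset.univ.filter (fun e : Fin n → P => Good (Finset.univ \ insert p F) e), wt x e)
          * f Finset.univ = (∑ r ∈ Finset.univ \ F, x r)⁻¹ * f (insert p F) := by
      intro p hp
      rw [mem_addable] at hp
      rw [mul_assoc, ih (insert p F)]
      · intro a ha b hab
        rw [Finset.mem_insert] at ha ⊢
        rcases ha with rfl | ha
        · rcases hab.eq_or_lt with h | h
          · exact Or.inl h.symm
          · exact Or.inr (hp.2.2 b h)
        · exact Or.inr (hF a ha b hab)
      · have he : Finset.univ \ insert p F = (Finset.univ \ F).erase p := by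
          ext r; simp
        rw [he, Finset.card_erase_of_mem (by simp [hp.2.1]), hc]; rfl
    rw [Finset.sum_congr rfl h2, ← Finset.mul_sum, ← hf F hF, ← mul_assoc, inv_mul_cancel₀ hx0, one_mul]

theorem lin_total {K : Type*} [Field K] (x : P → K) (f : Finset P → K)
    (hx : ∀ S : Finset P, S.Nonempty → ∑ r ∈ S, x r ≠ 0)
    (hf : ∀ F, Up F → (∑ r ∈ Finset.univ \ F, x r) * f F =
      ∑ p ∈ addable Finset.univ F, f (insert p F)) (h0 : f ∅ = 1) :
    (∑ e ∈ Finset.univ.filter (fun e : Fin (Fintype.card P) ≃ P => ∀ i j, e i < e j → j < i),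
      (∏ i : Fin (Fintype.card P), ∑ j ∈ Finset.univ.filter (fun j => i ≤ j), x (e j))⁻¹)
      = (f Finset.univ)⁻¹ := by
  have h := lin_sum x f hx hf (Fintype.card P) ∅ (by simp [Up]) (by simp)
  rw [h0] at h
  rw [← eq_inv_of_mul_eq_one_left h]
  refine Finset.sum_bij (fun e _ => (e : Fin (Fintype.card P) → P)) ?_ ?_ ?_ ?_
  · intro e he
    simp only [Finset.mem_filter, Finset.mem_univ, true_and] at he ⊢
    exact ⟨e.injective, by simp, he⟩
  · intro a _ b _ hab
    exact DFunLike.coe_injective hab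
  · intro e he
    simp only [Finset.mem_filter, Finset.mem_univ, true_and] at he
    refine ⟨Equiv.ofBijective e ((Fintype.bijective_iff_injective_and_card e).2 ⟨he.1, by simp⟩), ?_, rfl⟩
    simp only [Finset.mem_filter, Finset.mem_univ, true_and]
    exact he.2.2
  · intro e _
    rfl

theorem heap_formula {L : Type*} {lab : P → L} {Adj : L → L → Prop} (H : HeapAx lab Adj) :
    ∃ β : P → MvPolynomial L ℚ,
      (∑ e ∈ Finset.univ.filter (fun e : Fin (Fintype.card P) ≃ P => ∀ i j, e i < e j → j < i),
        (∏ i : Fin (Fintype.card P), ∑ j ∈ Finset.univ.filter (fun j => i ≤ j),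
          algebraMap (MvPolynomial L ℚ) (FractionRing (MvPolynomial L ℚ))
            (MvPolynomial.X (lab (e j))))⁻¹)
        = (∏ p : P, algebraMap (MvPolynomial L ℚ) (FractionRing (MvPolynomial L ℚ)) (β p))⁻¹ ∧
      (∀ a b, a < b → lab a = lab b → (∀ c, a < c → c < b → lab c ≠ lab a) →
        β b = ∑ r ∈ Finset.univ.filter (fun r => a < r ∧ r < b ∧ Adj (lab a) (lab r)), β r - β a) ∧
      (∀ b, (∀ a, a < b → lab a ≠ lab b) →
        β b = ∑ r ∈ Finset.univ.filter (· ≤ b), MvPolynomial.X (lab r)) := by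
  obtain ⟨G, β, hI⟩ := big_exists H _ (Finset.univ : Finset P) rfl (by simp [Up])
  refine ⟨β, ?_, fun a b => hI.b1 a (Finset.mem_univ _) b,
    fun b hb => (hI.b2 b (Finset.mem_univ _) hb).1⟩
  have := lin_total (fun p => algebraMap (MvPolynomial L ℚ) (FractionRing (MvPolynomial L ℚ))
            (MvPolynomial.X (lab p)))
    (fun F => algebraMap (MvPolynomial L ℚ) (FractionRing (MvPolynomial L ℚ)) (G F)) ?_ ?_ ?_
  · rw [this, hI.gQ, map_prod]
  · intro S hS h
    rw [← map_sum] at h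
    have h := (IsFractionRing.injective (MvPolynomial L ℚ) (FractionRing (MvPolynomial L ℚ)))
      (h.trans (map_zero _).symm)
    have := congrArg (MvPolynomial.aeval (fun _ => (1:ℚ))) h
    simp [hS.card_ne_zero] at this
  · intro F hF
    have := congrArg (algebraMap (MvPolynomial L ℚ) (FractionRing (MvPolynomial L ℚ)))
      (hI.recG F hF (Finset.subset_univ _))
    rw [map_mul, map_sum, xs, map_sum] at this
    exact this
  · simp [hI.g0]

end HeapPartD

section PartA
variable {P : Type*} [PartialOrder P] [Fintype P]

structure Dia (a b w z : P) : Prop where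
  nwz : ¬ w ≤ z
  nzw : ¬ z ≤ w
  aw : a < w
  az : a < z
  wb : w < b
  zb : z < b
  all : ∀ x, a ≤ x → x ≤ b → x = a ∨ x = b ∨ x = w ∨ x = z

structure DExt (a q c b : P) : Prop where
  aq : a < q
  cb : c < b
  all : ∀ x, a ≤ x → x ≤ b → x = a ∨ x = b ∨ (q ≤ x ∧ x ≤ c)

inductive DI : P → P → P → P → Prop
  | base {a b w z : P} : Dia a b w z → DI a b w z
  | step {a q c b w z : P} : DI q c w z → DExt a q c b → DI a b w z

theorem DI.facts {a b w z : P} (h : DI a b w z) :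
    ¬ w ≤ z ∧ ¬ z ≤ w ∧ a < w ∧ a < z ∧ w < b ∧ z < b := by
  induction h with
  | base h => exact ⟨h.nwz, h.nzw, h.aw, h.az, h.wb, h.zb⟩
  | step _ h ih => exact ⟨ih.1, ih.2.1, h.aq.trans ih.2.2.1, h.aq.trans ih.2.2.2.1,
      ih.2.2.2.2.1.trans h.cb, ih.2.2.2.2.2.trans h.cb⟩

theorem DI.lt {a b w z : P} (h : DI a b w z) : a < b := h.facts.2.2.1.trans h.facts.2.2.2.2.1

theorem of_isDk (n : ℕ) : ∀ {a b w z : P}, IsDkIntervalWith (n + 3) a b w z → DI a b w z := by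
  induction n with
  | zero =>
    rintro a b w z ⟨hab, ⟨_, hw, hz, nwz, nzw, hall, _, _, hT⟩, hN⟩
    have hT' : {x ∈ Set.Icc a b | x ≤ w ∧ x ≤ z} = {a} := by
      obtain ⟨t, ht⟩ := Set.ncard_eq_one.1 hT
      have : a ∈ {x ∈ Set.Icc a b | x ≤ w ∧ x ≤ z} := ⟨⟨le_rfl, hab⟩, hw.1, hz.1⟩
      rw [ht] at this ⊢
      rw [Set.mem_singleton_iff.1 this]
    have hN' : {x ∈ Set.Icc a b | w ≤ x ∧ z ≤ x} = {b} := by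
      obtain ⟨t, ht⟩ := Set.ncard_eq_one.1 hN
      have : b ∈ {x ∈ Set.Icc a b | w ≤ x ∧ z ≤ x} := ⟨⟨hab, le_rfl⟩, hw.2, hz.2⟩
      rw [ht] at this ⊢
      rw [Set.mem_singleton_iff.1 this]
    refine .base ⟨nwz, nzw, lt_of_le_of_ne hw.1 ?_, lt_of_le_of_ne hz.1 ?_, lt_of_le_of_ne hw.2 ?_,
      lt_of_le_of_ne hz.2 ?_, ?_⟩
    · rintro rfl; exact nwz hz.1
    · rintro rfl; exact nzw hw.1
    · rintro rfl; exact nzw hz.2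
    · rintro rfl; exact nwz hw.2
    · intro x h1 h2
      rcases hall x ⟨h1, h2⟩ with h | h | h | h
      · simp [h]
      · simp [h]
      · have : x ∈ {x ∈ Set.Icc a b | x ≤ w ∧ x ≤ z} := ⟨⟨h1, h2⟩, h⟩
        rw [hT'] at this
        exact Or.inl this
      · have : x ∈ {x ∈ Set.Icc a b | w ≤ x ∧ z ≤ x} := ⟨⟨h1, h2⟩, h⟩
        rw [hN'] at this
        exact Or.inr (Or.inl this)
  | succ n ih =>
    rintro a b w z ⟨hab, ⟨_, hw, hz, nwz, nzw, hall, cT, cN, hT⟩, hN⟩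
    have haT : a ∈ {x ∈ Set.Icc a b | x ≤ w ∧ x ≤ z} := ⟨⟨le_rfl, hab⟩, hw.1, hz.1⟩
    have hbN : b ∈ {x ∈ Set.Icc a b | w ≤ x ∧ z ≤ x} := ⟨⟨hab, le_rfl⟩, hw.2, hz.2⟩
    set T := {x ∈ Set.Icc a b | x ≤ w ∧ x ≤ z} with hTd
    set N := {x ∈ Set.Icc a b | w ≤ x ∧ z ≤ x} with hNd
    have hT2 : (T \ {a}).ncard = n + 1 := by
      rw [Set.ncard_sdiff_singleton_of_mem haT, hT]; omega
    have hN2 : (N \ {b}).ncard = n + 1 := by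
      rw [Set.ncard_sdiff_singleton_of_mem hbN, hN]; omega
    have hTne : (T \ {a}).Nonempty := by
      rw [← Set.ncard_pos (Set.toFinite _)]; omega
    have hNne : (N \ {b}).Nonempty := by
      rw [← Set.ncard_pos (Set.toFinite _)]; omega
    obtain ⟨q, hq⟩ := (Set.toFinite (T \ {a})).exists_minimal hTne
    obtain ⟨c, hc⟩ := (Set.toFinite (N \ {b})).exists_maximal hNne
    have hqT : ∀ x ∈ T, x ≠ a → q ≤ x := by
      intro x hx hxa
      by_cases hxq : x = q
      · exact hxq.ge
      rcases cT hx hq.1.1 hxq with h | h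
      · exact hq.2 ⟨hx, hxa⟩ h
      · exact h
    have hcN : ∀ x ∈ N, x ≠ b → x ≤ c := by
      intro x hx hxa
      by_cases hxq : x = c
      · exact hxq.le
      rcases cN hx hc.1.1 hxq with h | h
      · exact h
      · exact hc.2 ⟨hx, hxa⟩ h
    have haq : a < q := lt_of_le_of_ne hq.1.1.1.1 (fun h => hq.1.2 h.symm)
    have hcb : c < b := lt_of_le_of_ne hc.1.1.1.2 (fun h => hc.1.2 h)
    have hqw : q ≤ w := hq.1.1.2.1
    have hqz : q ≤ z := hq.1.1.2.2
    have hwc : w ≤ c := hc.1.1.2.1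
    have hzc : z ≤ c := hc.1.1.2.2
    have hT3 : {x ∈ Set.Icc q c | x ≤ w ∧ x ≤ z} = T \ {a} := by
      ext x
      constructor
      · rintro ⟨h1, h2⟩
        exact ⟨⟨⟨haq.le.trans h1.1, h1.2.trans hcb.le⟩, h2⟩, fun h => (haq.trans_le h1.1).ne' h⟩
      · rintro ⟨h1, h2⟩
        exact ⟨⟨hqT x h1 h2, h1.2.1.trans hwc⟩, h1.2⟩
    have hN3 : {x ∈ Set.Icc q c | w ≤ x ∧ z ≤ x} = N \ {b} := by
      ext x
      constructor
      · rintro ⟨h1, h2⟩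
        exact ⟨⟨⟨haq.le.trans h1.1, h1.2.trans hcb.le⟩, h2⟩, fun h => (h1.2.trans_lt hcb).ne h⟩
      · rintro ⟨h1, h2⟩
        exact ⟨⟨hqw.trans h1.2.1, hcN x h1 h2⟩, h1.2⟩
    refine .step (q := q) (c := c) (ih ⟨hqw.trans hwc, ⟨by omega, ⟨hqw, hwc⟩, ⟨hqz, hzc⟩, nwz, nzw,
      ?_, ?_, ?_, ?_⟩, ?_⟩) ⟨haq, hcb, ?_⟩
    · intro x hx
      exact hall x ⟨haq.le.trans hx.1, hx.2.trans hcb.le⟩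
    · rw [hT3]; exact cT.mono Set.sdiff_subset
    · rw [hN3]; exact cN.mono Set.sdiff_subset
    · rw [hT3, hT2]; omega
    · rw [hN3, hN2]; omega
    · intro x h1 h2
      by_cases hxa : x = a
      · exact Or.inl hxa
      by_cases hxb : x = b
      · exact Or.inr (Or.inl hxb)
      refine Or.inr (Or.inr ?_)
      rcases hall x ⟨h1, h2⟩ with h | h | h | h
      · rw [h]; exact ⟨hqw, hwc⟩
      · rw [h]; exact ⟨hqz, hzc⟩
      · exact ⟨hqT x ⟨⟨h1, h2⟩, h⟩ hxa, h.1.trans hwc⟩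
      · exact ⟨hqw.trans h.1, hcN x ⟨⟨h1, h2⟩, h⟩ hxb⟩

theorem DI.isDk {a b w z : P} (h : DI a b w z) : ∃ n : ℕ, IsDkIntervalWith (n + 3) a b w z := by
  induction h with
  | @base a b w z h =>
    have hT : {x ∈ Set.Icc a b | x ≤ w ∧ x ≤ z} = {a} := by
      ext x
      constructor
      · rintro ⟨⟨h1, h2⟩, h3, h4⟩
        rcases h.all x h1 h2 with rfl | rfl | rfl | rfl
        · rfl
        · exact absurd (h.zb.le.trans h3) h.nzw
        · exact absurd h4 h.nwz
        · exact absurd h3 h.nzw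
      · rintro rfl
        exact ⟨⟨le_rfl, h.aw.le.trans h.wb.le⟩, h.aw.le, h.az.le⟩
    have hN : {x ∈ Set.Icc a b | w ≤ x ∧ z ≤ x} = {b} := by
      ext x
      constructor
      · rintro ⟨⟨h1, h2⟩, h3, h4⟩
        rcases h.all x h1 h2 with rfl | rfl | rfl | rfl
        · exact absurd (h3.trans h.az.le) h.nwz
        · rfl
        · exact absurd h4 h.nzw
        · exact absurd h3 h.nwz
      · rintro rfl
        exact ⟨⟨h.aw.le.trans h.wb.le, le_rfl⟩, h.wb.le, h.zb.le⟩
    refine ⟨0, h.aw.le.trans h.wb.le, ⟨by omega, ⟨h.aw.le, h.wb.le⟩, ⟨h.az.le, h.zb.le⟩, h.nwz, h.nzw,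
      ?_, ?_, ?_, ?_⟩, ?_⟩
    · rintro x ⟨h1, h2⟩
      rcases h.all x h1 h2 with rfl | rfl | rfl | rfl
      · exact Or.inr (Or.inr (Or.inl ⟨h.aw.le, h.az.le⟩))
      · exact Or.inr (Or.inr (Or.inr ⟨h.wb.le, h.zb.le⟩))
      · simp
      · simp
    · rw [hT]; exact Set.subsingleton_singleton.isChain
    · rw [hN]; exact Set.subsingleton_singleton.isChain
    · rw [hT]; simp
    · rw [hN]; simp
  | @step a q c b w z hd h ih =>
    obtain ⟨n, hqc, ⟨_, hw, hz, nwz, nzw, hall, cT, cN, hT⟩, hN⟩ := ih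
    have haw := h.aq.trans_le hw.1
    have haz := h.aq.trans_le hz.1
    have hwb := hw.2.trans_lt h.cb
    have hzb := hz.2.trans_lt h.cb
    have hab := haw.trans hwb
    have hT3 : {x ∈ Set.Icc a b | x ≤ w ∧ x ≤ z} = insert a {x ∈ Set.Icc q c | x ≤ w ∧ x ≤ z} := by
      ext x
      constructor
      · rintro ⟨⟨h1, h2⟩, h3, h4⟩
        rcases h.all x h1 h2 with rfl | rfl | h'
        · exact Or.inl rfl
        · exact absurd h3 hwb.not_ge
        · exact Or.inr ⟨h', h3, h4⟩
      · rintro (rfl | ⟨⟨h1, h2⟩, h3⟩)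
        · exact ⟨⟨le_rfl, hab.le⟩, haw.le, haz.le⟩
        · exact ⟨⟨h.aq.le.trans h1, h2.trans h.cb.le⟩, h3⟩
    have hN3 : {x ∈ Set.Icc a b | w ≤ x ∧ z ≤ x} = insert b {x ∈ Set.Icc q c | w ≤ x ∧ z ≤ x} := by
      ext x
      constructor
      · rintro ⟨⟨h1, h2⟩, h3, h4⟩
        rcases h.all x h1 h2 with rfl | rfl | h'
        · exact absurd h3 haw.not_ge
        · exact Or.inl rfl
        · exact Or.inr ⟨h', h3, h4⟩
      · rintro (rfl | ⟨⟨h1, h2⟩, h3⟩)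
        · exact ⟨⟨hab.le, le_rfl⟩, hwb.le, hzb.le⟩
        · exact ⟨⟨h.aq.le.trans h1, h2.trans h.cb.le⟩, h3⟩
    refine ⟨n + 1, hab.le, ⟨by omega, ⟨haw.le, hwb.le⟩, ⟨haz.le, hzb.le⟩, nwz, nzw,
      ?_, ?_, ?_, ?_⟩, ?_⟩
    · rintro x ⟨h1, h2⟩
      rcases h.all x h1 h2 with rfl | rfl | h'
      · exact Or.inr (Or.inr (Or.inl ⟨haw.le, haz.le⟩))
      · exact Or.inr (Or.inr (Or.inr ⟨hwb.le, hzb.le⟩))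
      · exact hall x h'
    · rw [hT3]
      exact cT.insert fun x hx _ => Or.inl (h.aq.le.trans hx.1.1)
    · rw [hN3]
      exact cN.insert fun x hx _ => Or.inr (hx.1.2.trans h.cb.le)
    · rw [hT3, Set.ncard_insert_of_notMem, hT]
      · omega
      · exact fun hx => hx.1.1.not_gt h.aq
    · rw [hN3, Set.ncard_insert_of_notMem, hN]
      · omega
      · exact fun hx => hx.1.2.not_gt h.cb

theorem isDIW_iff {a b w z : P} : IsDIntervalWith a b w z ↔ DI a b w z := by
  constructor
  · rintro ⟨k, h⟩
    have h3 : 3 ≤ k := h.2.1.1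
    obtain ⟨n, rfl⟩ := Nat.exists_eq_add_of_le h3
    rw [add_comm] at h
    exact of_isDk n h
  · intro h
    obtain ⟨n, h⟩ := h.isDk
    exact ⟨_, h⟩

theorem isDI_iff {a b : P} : IsDInterval a b ↔ ∃ w z, DI a b w z := by
  constructor
  · rintro ⟨k, w, z, h⟩
    exact ⟨w, z, isDIW_iff.1 ⟨k, h⟩⟩
  · rintro ⟨w, z, h⟩
    obtain ⟨k, h⟩ := isDIW_iff.2 h
    exact ⟨k, w, z, h⟩

theorem minus3 {a w z : P} (nwz : ¬ w ≤ z) (nzw : ¬ z ≤ w) (aw : a < w) (az : a < z)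
    (hw : ∀ x, a ≤ x → x ≤ w → x = a ∨ x = w) (hz : ∀ x, a ≤ x → x ≤ z → x = a ∨ x = z) :
    IsDkMinusConvex 3 ({a, w, z} : Set P) := by
  have hT : {x ∈ ({a, w, z} : Set P) | x ≤ w ∧ x ≤ z} = {a} := by
    ext x
    constructor
    · rintro ⟨rfl | rfl | rfl, h1, h2⟩
      · rfl
      · exact absurd h2 nwz
      · exact absurd h1 nzw
    · rintro rfl
      exact ⟨Or.inl rfl, aw.le, az.le⟩
  have hN : {x ∈ ({a, w, z} : Set P) | w ≤ x ∧ z ≤ x} = ∅ := by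
    ext x
    constructor
    · rintro ⟨rfl | rfl | rfl, h1, h2⟩
      · exact aw.not_ge h1
      · exact absurd h2 nzw
      · exact absurd h1 nwz
    · exact fun h => h.elim
  refine ⟨?_, w, z, ⟨le_rfl, by simp, by simp, nwz, nzw, ?_, ?_, ?_, ?_⟩, ?_⟩
  · have hle : ∀ x ∈ ({a, w, z} : Set P), a ≤ x := by
      rintro x (rfl | rfl | rfl)
      exacts [le_rfl, aw.le, az.le]
    intro s hs t ht x h1 h2
    have hx := (hle s hs).trans h1
    rcases ht with rfl | rfl | rfl
    · exact Or.inl (le_antisymm h2 hx)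
    · rcases hw x hx h2 with h | h <;> simp [h]
    · rcases hz x hx h2 with h | h <;> simp [h]
  · rintro x (rfl | rfl | rfl)
    · exact Or.inr (Or.inr (Or.inl ⟨aw.le, az.le⟩))
    · simp
    · simp
  · rw [hT]; exact Set.subsingleton_singleton.isChain
  · rw [hN]; exact Set.subsingleton_empty.isChain
  · rw [hT]; simp
  · rw [hN]; simp

theorem minusk {a q c w z : P} (h : DI q c w z) (aq : a < q)
    (hx : ∀ x, a ≤ x → x ≤ c → x = a ∨ q ≤ x) :
    ∃ k, IsDkMinusConvex k (insert a (Set.Icc q c)) := by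
  obtain ⟨n, hqc, ⟨_, hw, hz, nwz, nzw, hall, cT, cN, hT⟩, hN⟩ := h.isDk
  have haw := aq.trans_le hw.1
  have haz := aq.trans_le hz.1
  have hT3 : {x ∈ insert a (Set.Icc q c) | x ≤ w ∧ x ≤ z} = insert a {x ∈ Set.Icc q c | x ≤ w ∧ x ≤ z} := by
    ext x
    constructor
    · rintro ⟨rfl | h1, h3⟩
      · exact Or.inl rfl
      · exact Or.inr ⟨h1, h3⟩
    · rintro (rfl | h1)
      · exact ⟨Or.inl rfl, haw.le, haz.le⟩
      · exact ⟨Or.inr h1.1, h1.2⟩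
  have hN3 : {x ∈ insert a (Set.Icc q c) | w ≤ x ∧ z ≤ x} = {x ∈ Set.Icc q c | w ≤ x ∧ z ≤ x} := by
    ext x
    constructor
    · rintro ⟨rfl | h1, h3⟩
      · exact absurd h3.1 haw.not_ge
      · exact ⟨h1, h3⟩
    · intro h1
      exact ⟨Or.inr h1.1, h1.2⟩
  refine ⟨n + 4, ?_, w, z, ⟨by omega, Or.inr hw, Or.inr hz, nwz, nzw, ?_, ?_, ?_, ?_⟩, ?_⟩
  · rintro s hs t ht x h1 h2
    have hs' : a ≤ s := by
      rcases hs with rfl | hs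
      · exact le_rfl
      · exact aq.le.trans hs.1
    have ht' : t ≤ c := by
      rcases ht with rfl | ht
      · exact aq.le.trans hqc
      · exact ht.2
    rcases hx x (hs'.trans h1) (h2.trans ht') with h | h
    · exact Or.inl h
    · exact Or.inr ⟨h, h2.trans ht'⟩
  · rintro x (rfl | h)
    · exact Or.inr (Or.inr (Or.inl ⟨haw.le, haz.le⟩))
    · exact hall x h
  · rw [hT3]
    exact cT.insert fun x hx _ => Or.inl (aq.le.trans hx.1.1)
  · rwa [hN3]
  · rw [hT3, Set.ncard_insert_of_notMem, hT]
    · omega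
    · exact fun hx => hx.1.1.not_gt aq
  · rw [hN3, hN]; omega

/-- extracted consequences of the axioms -/
structure DC (P : Type*) [PartialOrder P] : Prop where
  e1 : ∀ a w z : P, a ⋖ w → a ⋖ z → w ≠ z → ∃ b, Dia a b w z
  e2 : ∀ a q c w z : P, DI q c w z → a ⋖ q → (∀ u, a ⋖ u → u = q) → ∃ b, DExt a q c b
  a2 : ∀ a b w z x : P, DI a b w z → x ⋖ b → a ≤ x
  a3 : ∀ a a' b b' w z : P, Dia a b w z → Dia a' b' w z → a = a'
  a3' : ∀ a a' b b' q c w z : P, DI q c w z → DExt a q c b → DExt a' q c b' → a = a'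

theorem complete {S : Set P} {k : ℕ} (hP : IsDComplete P) (hS : IsDkMinusConvex k S) {a : P} (ha : a ∈ S)
    (hmin : ∀ x ∈ S, a ≤ x) : ∃ b, b ∉ S ∧ a ≤ b ∧ Set.Icc a b = insert b S := by
  obtain ⟨b, hb, a', ⟨w, z, hab, _⟩, hI⟩ := hP.1 k S hS
  have h1 : a' ≤ a := by
    have : a ∈ Set.Icc a' b := by rw [hI]; exact Or.inr ha
    exact this.1
  have h2 : a' ∈ insert b S := by rw [← hI]; exact ⟨le_rfl, hab⟩
  have h3 : a' = a := by
    rcases h2 with rfl | h2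
    · have : a ∈ Set.Icc a' a' := by rw [hI]; exact Or.inr ha
      exact le_antisymm this.1 this.2
    · exact le_antisymm h1 (hmin _ h2)
  subst h3
  exact ⟨b, hb, hab, hI⟩

theorem IsDComplete.dc (hP : IsDComplete P) : DC P := by
  constructor
  · intro a w z hw hz hne
    have nwz : ¬ w ≤ z := fun h => hz.2 hw.lt (lt_of_le_of_ne h hne)
    have nzw : ¬ z ≤ w := fun h => hw.2 hz.lt (lt_of_le_of_ne h hne.symm)
    have hm := minus3 nwz nzw hw.lt hz.lt
      (fun x h1 h2 => hw.eq_or_eq h1 h2) (fun x h1 h2 => hz.eq_or_eq h1 h2)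
    obtain ⟨b, hb, hab, hI⟩ := complete hP hm (a := a) (by simp) (by
      rintro x (rfl | rfl | rfl)
      exacts [le_rfl, hw.le, hz.le])
    have hle : ∀ x ∈ ({a, w, z} : Set P), x < b := by
      intro x hx
      have : x ∈ Set.Icc a b := by rw [hI]; exact Or.inr hx
      exact lt_of_le_of_ne this.2 (fun h => hb (h ▸ hx))
    refine ⟨b, nwz, nzw, hw.lt, hz.lt, hle w (by simp), hle z (by simp), ?_⟩
    intro x h1 h2
    have : x ∈ Set.Icc a b := ⟨h1, h2⟩
    rw [hI] at this
    simp only [Set.mem_insert_iff, Set.mem_singleton_iff] at this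
    tauto
  · intro a q c w z hd haq hu
    obtain ⟨k, hm⟩ := minusk hd haq.lt (fun x h1 h2 => by
      rcases h1.eq_or_lt with h | h
      · exact Or.inl h.symm
      · obtain ⟨u, hau, hux⟩ := exists_covBy_le_of_lt h
        exact Or.inr (hu u hau ▸ hux))
    obtain ⟨b, hb, hab, hI⟩ := complete hP hm (a := a) (by simp) (by
      rintro x (rfl | hx)
      exacts [le_rfl, haq.le.trans hx.1])
    have hcS : c ∈ insert a (Set.Icc q c) := Or.inr ⟨hd.lt.le, le_rfl⟩
    refine ⟨b, haq.lt, ?_, ?_⟩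
    · have : c ∈ Set.Icc a b := by rw [hI]; exact Or.inr hcS
      exact lt_of_le_of_ne this.2 (fun h => hb (h ▸ hcS))
    · intro x h1 h2
      have : x ∈ Set.Icc a b := ⟨h1, h2⟩
      rw [hI] at this
      simp only [Set.mem_insert_iff, Set.mem_Icc] at this
      tauto
  · intro a b w z x hd hx
    exact (hP.2.1 a b (isDI_iff.2 ⟨w, z, hd⟩) x hx).1
  · intro a a' b b' w z h h'
    have cv : ∀ {a b : P}, Dia a b w z → (∀ x, a ≤ x → x ≤ w → x = a ∨ x = w) ∧
        (∀ x, a ≤ x → x ≤ z → x = a ∨ x = z) := by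
      intro a b h
      constructor
      · intro x h1 h2
        rcases h.all x h1 (h2.trans h.wb.le) with h3 | h3 | h3 | h3
        · exact Or.inl h3
        · exact absurd (h3 ▸ h2) h.wb.not_ge
        · exact Or.inr h3
        · exact absurd (h3 ▸ h2) h.nzw
      · intro x h1 h2
        rcases h.all x h1 (h2.trans h.zb.le) with h3 | h3 | h3 | h3
        · exact Or.inl h3
        · exact absurd (h3 ▸ h2) h.zb.not_ge
        · exact absurd (h3 ▸ h2) h.nwz
        · exact Or.inr h3
    have hm := minus3 h.nwz h.nzw h.aw h.az (cv h).1 (cv h).2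
    have hm' := minus3 h.nwz h.nzw h'.aw h'.az (cv h').1 (cv h').2
    have := hP.2.2 3 3 _ _ hm hm' a (by simp) a' (by simp) (by
      rintro x (rfl | rfl | rfl)
      exacts [le_rfl, h.aw.le, h.az.le]) (by
      rintro x (rfl | rfl | rfl)
      exacts [le_rfl, h'.aw.le, h'.az.le]) (by
      have e1 := h.aw.ne'
      have e2 := h.az.ne'
      have e3 := h'.aw.ne'
      have e4 := h'.az.ne'
      ext x
      simp only [Set.mem_sdiff, Set.mem_insert_iff, Set.mem_singleton_iff]
      grind)
    have ha : a ∈ ({a', w, z} : Set P) := by rw [← this]; simp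
    rcases ha with h1 | h1 | h1
    · exact h1
    · exact absurd h1 h.aw.ne
    · exact absurd h1 h.az.ne
  · intro a a' b b' q c w z hd h h'
    obtain ⟨k, hm⟩ := minusk hd h.aq (fun x h1 h2 => by
      rcases h.all x h1 (h2.trans h.cb.le) with h3 | h3 | h3
      · exact Or.inl h3
      · exact absurd (h3 ▸ h2) h.cb.not_ge
      · exact Or.inr h3.1)
    obtain ⟨k', hm'⟩ := minusk hd h'.aq (fun x h1 h2 => by
      rcases h'.all x h1 (h2.trans h'.cb.le) with h3 | h3 | h3
      · exact Or.inl h3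
      · exact absurd (h3 ▸ h2) h'.cb.not_ge
      · exact Or.inr h3.1)
    have := hP.2.2 k k' _ _ hm hm' a (by simp) a' (by simp) (by
      rintro x (rfl | hx)
      exacts [le_rfl, h.aq.le.trans hx.1]) (by
      rintro x (rfl | hx)
      exacts [le_rfl, h'.aq.le.trans hx.1]) (by
      ext x
      simp only [Set.mem_sdiff, Set.mem_insert_iff, Set.mem_singleton_iff, Set.mem_Icc]
      constructor
      · rintro ⟨h1 | h1, h2⟩
        · exact absurd h1 h2
        · exact ⟨Or.inr h1, (h'.aq.trans_le h1.1).ne'⟩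
      · rintro ⟨h1 | h1, h2⟩
        · exact absurd h1 h2
        · exact ⟨Or.inr h1, (h.aq.trans_le h1.1).ne'⟩)
    have ha : a ∈ insert a' (Set.Icc q c) := by rw [← this]; simp
    rcases ha with h1 | h1
    · exact h1
    · exact absurd h1.1 h.aq.not_ge

end PartA

section PartB
variable {P : Type*} [PartialOrder P] [Fintype P]

theorem Dia.symm {a b w z : P} (h : Dia a b w z) : Dia a b z w :=
  ⟨h.nzw, h.nwz, h.az, h.aw, h.zb, h.wb, fun x h1 h2 => by have := h.all x h1 h2; tauto⟩

theorem Dia.cov_aw {a b w z : P} (h : Dia a b w z) : a ⋖ w := by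
  refine ⟨h.aw, fun x h1 h2 => ?_⟩
  rcases h.all x h1.le (h2.le.trans h.wb.le) with h3 | h3 | h3 | h3
  · exact h1.ne' h3
  · exact (h2.trans h.wb).ne h3
  · exact h2.ne h3
  · exact h.nzw (h3 ▸ h2.le)

theorem Dia.cov_wb {a b w z : P} (h : Dia a b w z) : w ⋖ b := by
  refine ⟨h.wb, fun x h1 h2 => ?_⟩
  rcases h.all x (h.aw.le.trans h1.le) h2.le with h3 | h3 | h3 | h3
  · exact (h.aw.trans h1).ne' h3
  · exact h2.ne h3
  · exact h1.ne' h3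
  · exact h.nwz (h3 ▸ h1.le)

theorem Dia.up {a b w z u : P} (h : Dia a b w z) (h1 : a ⋖ u) (h2 : u ≤ b) : u = w ∨ u = z := by
  rcases h.all u h1.le h2 with h3 | h3 | h3
  · exact absurd h3 h1.lt.ne'
  · exact absurd h.wb (h3 ▸ h1.2 h.aw)
  · exact h3

theorem Dia.down {a b w z u : P} (h : Dia a b w z) (h1 : u ⋖ b) (h2 : a ≤ u) : u = w ∨ u = z := by
  rcases h.all u h2 h1.le with h3 | h3 | h3
  · exact absurd h.wb (h1.2 (h3 ▸ h.aw))
  · exact absurd h3 h1.lt.ne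
  · exact h3

theorem DExt.cov_aq {a q c b : P} (h : DExt a q c b) (hqc : q < c) : a ⋖ q := by
  refine ⟨h.aq, fun x h1 h2 => ?_⟩
  rcases h.all x h1.le ((h2.trans hqc).trans h.cb).le with h3 | h3 | h3
  · exact h1.ne' h3
  · exact ((h2.trans hqc).trans h.cb).ne h3
  · exact h2.not_ge h3.1

theorem DExt.cov_cb {a q c b : P} (h : DExt a q c b) (hqc : q < c) : c ⋖ b := by
  refine ⟨h.cb, fun x h1 h2 => ?_⟩
  rcases h.all x ((h.aq.trans hqc).trans h1).le h2.le with h3 | h3 | h3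
  · exact ((h.aq.trans hqc).trans h1).ne' h3
  · exact h2.ne h3
  · exact h1.not_ge h3.2

theorem DExt.up {a q c b u : P} (h : DExt a q c b) (hqc : q < c) (h1 : a ⋖ u) (h2 : u ≤ b) : u = q := by
  rcases h.all u h1.le h2 with h3 | h3 | h3
  · exact absurd h3 h1.lt.ne'
  · exact absurd (hqc.trans h.cb) (h3 ▸ h1.2 h.aq)
  · by_contra hne
    exact h1.2 h.aq (lt_of_le_of_ne h3.1 (Ne.symm hne))

theorem DExt.down {a q c b u : P} (h : DExt a q c b) (hqc : q < c) (h1 : u ⋖ b) (h2 : a ≤ u) : u = c := by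
  rcases h.all u h2 h1.le with h3 | h3 | h3
  · exact absurd h.cb (h1.2 (h3 ▸ h.aq.trans hqc))
  · exact absurd h3 h1.lt.ne
  · by_contra hne
    exact h1.2 (lt_of_le_of_ne h3.2 hne) h.cb

theorem DC.dia_down (D : DC P) {a b w z u : P} (h : Dia a b w z) (h1 : u ⋖ b) : u = w ∨ u = z :=
  h.down h1 (D.a2 _ _ _ _ _ (.base h) h1)

theorem DC.ext_down (D : DC P) {a q c b w z u : P} (hd : DI q c w z) (h : DExt a q c b) (h1 : u ⋖ b) :
    u = c :=
  h.down hd.lt h1 (D.a2 _ _ _ _ _ (.step hd h) h1)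

theorem DC.crown (D : DC P) (w1 : P) : ∀ w2 w3 b1 b2 b3 : P, b1 ≠ b2 → b1 ≠ b3 → b2 ≠ b3 →
    w1 ⋖ b2 → w1 ⋖ b3 → w2 ⋖ b1 → w2 ⋖ b3 → w3 ⋖ b1 → w3 ⋖ b2 → False := by
  induction w1 using WellFoundedGT.induction with
  | ind w1 ih =>
    intro w2 w3 b1 b2 b3 n12 n13 n23 h12 h13 h21 h23 h31 h32
    obtain ⟨c1, d1⟩ := D.e1 _ _ _ h12 h13 n23
    obtain ⟨c2, d2⟩ := D.e1 _ _ _ h21 h23 n13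
    obtain ⟨c3, d3⟩ := D.e1 _ _ _ h31 h32 n12
    refine ih b2 h12.lt b1 b3 c2 c1 c3 ?_ ?_ ?_ d1.cov_wb d3.symm.cov_wb d2.cov_wb d3.cov_wb
      d2.symm.cov_wb d1.symm.cov_wb
    · rintro rfl
      rcases D.dia_down d1 d2.cov_wb with h | h
      · exact n12 h
      · exact n13 h
    · rintro rfl
      rcases D.dia_down d2 d3.symm.cov_wb with h | h
      · exact n12 h.symm
      · exact n23 h
    · rintro rfl
      rcases D.dia_down d1 d3.cov_wb with h | h
      · exact n12 h
      · exact n13 h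

theorem DC.two (D : DC P) {a w1 w2 w3 : P} (h1 : a ⋖ w1) (h2 : a ⋖ w2) (h3 : a ⋖ w3)
    (n12 : w1 ≠ w2) : w3 = w1 ∨ w3 = w2 := by
  by_contra hcon
  push Not at hcon
  obtain ⟨n31, n32⟩ := hcon
  obtain ⟨b3, d3⟩ := D.e1 _ _ _ h1 h2 n12
  obtain ⟨b2, d2⟩ := D.e1 _ _ _ h1 h3 n31.symm
  obtain ⟨b1, d1⟩ := D.e1 _ _ _ h2 h3 n32.symm
  refine D.crown w1 w2 w3 b1 b2 b3 ?_ ?_ ?_ d2.cov_wb d3.cov_wb d1.cov_wb d3.symm.cov_wb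
    d1.symm.cov_wb d2.symm.cov_wb
  · rintro rfl
    rcases D.dia_down d1 d2.cov_wb with h | h
    · exact n12 h
    · exact n31 h.symm
  · rintro rfl
    rcases D.dia_down d3 d1.symm.cov_wb with h | h
    · exact n31 h
    · exact n32 h
  · rintro rfl
    rcases D.dia_down d3 d2.symm.cov_wb with h | h
    · exact n31 h
    · exact n32 h

theorem DC.bot_unique (D : DC P) {a b w z : P} (h : DI a b w z) :
    ∀ {a' w' z' : P}, DI a' b w' z' → a = a' := by
  induction h with
  | @base a b w z h =>
    intro a' w' z' h'
    cases h' with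
    | base h' =>
      have hne : w' ≠ z' := fun e => h'.nwz e.le
      rcases D.dia_down h h'.cov_wb with e1 | e1 <;> rcases D.dia_down h h'.symm.cov_wb with e2 | e2
      · exact absurd (e1.trans e2.symm) hne
      · subst e1 e2; exact D.a3 _ _ _ _ _ _ h h'
      · subst e1 e2; exact D.a3 _ _ _ _ _ _ h h'.symm
      · exact absurd (e1.trans e2.symm) hne
    | step hd h' =>
      have e1 := D.ext_down hd h' h.cov_wb
      have e2 := D.ext_down hd h' h.symm.cov_wb
      exact absurd (e1.trans e2.symm).le h.nwz
  | @step a q c b w z hd h ih =>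
    intro a' w' z' h'
    cases h' with
    | base h' =>
      have e1 := D.ext_down hd h h'.cov_wb
      have e2 := D.ext_down hd h h'.symm.cov_wb
      exact absurd (e1.trans e2.symm).le h'.nwz
    | step hd' h' =>
      have e1 := D.ext_down hd h (h'.cov_cb hd'.lt)
      subst e1
      have e2 := ih hd'
      subst e2
      exact D.a3' _ _ _ _ _ _ _ _ hd h h'

theorem DC.up_le (D : DC P) {a b w z : P} (h : DI a b w z) : ∀ {u : P}, a ⋖ u → u ≤ b := by
  induction h with
  | @base a b w z h =>
    intro u hu
    rcases D.two h.cov_aw h.symm.cov_aw hu (fun e => h.nwz e.le) with rfl | rfl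
    · exact h.wb.le
    · exact h.zb.le
  | @step a q c b w z hd h ih =>
    intro u hu
    by_cases hne : u = q
    · subst hne; exact (hd.lt.trans h.cb).le
    · obtain ⟨t, ht⟩ := D.e1 _ _ _ (h.cov_aq hd.lt) hu (Ne.symm hne)
      exact ht.zb.le.trans ((ih ht.cov_wb).trans h.cb.le)

theorem DC.dia_up (D : DC P) {a b w z u : P} (h : Dia a b w z) (h1 : a ⋖ u) : u = w ∨ u = z :=
  h.up h1 (D.up_le (.base h) h1)

theorem DC.ext_up (D : DC P) {a q c b w z u : P} (hd : DI q c w z) (h : DExt a q c b) (h1 : a ⋖ u) :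
    u = q :=
  h.up hd.lt h1 (D.up_le (.step hd h) h1)

theorem DC.lemN (D : DC P) {a b w z : P} (h : DI a b w z) : ∀ {e w' z' : P}, DI b e w' z' →
    (∀ u, b ⋖ u → ∀ y, y ⋖ u → y = b) → False := by
  induction h with
  | @base a b w z h =>
    intro e w' z' he hu
    have key : ∀ y, y ⋖ b → ∃ f, DExt y b e f := by
      intro y hy
      refine D.e2 _ _ _ _ _ he hy fun u hyu => ?_
      by_contra hne
      obtain ⟨t, ht⟩ := D.e1 _ _ _ hy hyu (Ne.symm hne)
      exact hne (hu t ht.cov_wb u ht.symm.cov_wb)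
    obtain ⟨f, hf⟩ := key w h.cov_wb
    obtain ⟨f', hf'⟩ := key z h.symm.cov_wb
    exact h.nwz (D.a3' _ _ _ _ _ _ _ _ he hf hf').le
  | @step a q c b w z hd h ih =>
    intro e w' z' he hu
    have hcb := h.cov_cb hd.lt
    have hun : ∀ u, c ⋖ u → u = b := by
      intro u hyu
      by_contra hne
      obtain ⟨t, ht⟩ := D.e1 _ _ _ hcb hyu (Ne.symm hne)
      exact hne (hu t ht.cov_wb u ht.symm.cov_wb)
    obtain ⟨f, hf⟩ := D.e2 _ _ _ _ _ he hcb hun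
    refine ih (.step he hf) fun u hcu y hyu => ?_
    rw [hun u hcu] at hyu
    exact D.ext_down hd h hyu

theorem DC.top_unique (D : DC P) {a b w z : P} (h : DI a b w z) :
    ∀ {b' w' z' : P}, DI a b' w' z' → b = b' := by
  induction h with
  | @base a b w z h =>
    intro b' w' z' h'
    cases h' with
    | base h' =>
      by_contra hne
      have aux : ∀ {w z : P}, Dia a b w z → Dia a b' w z → False := by
        intro w z h h'
        obtain ⟨c, hc⟩ := D.e1 _ _ _ h.cov_wb h'.cov_wb hne
        obtain ⟨c', hc'⟩ := D.e1 _ _ _ h.symm.cov_wb h'.symm.cov_wb hne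
        exact h.nwz (D.a3 _ _ _ _ _ _ hc hc').le
      have hne : w' ≠ z' := fun e => h'.nwz e.le
      rcases D.dia_up h h'.cov_aw with e1 | e1 <;> rcases D.dia_up h h'.symm.cov_aw with e2 | e2
      · exact absurd (e1.trans e2.symm) hne
      · subst e1 e2; exact aux h h'
      · subst e1 e2; exact aux h h'.symm
      · exact absurd (e1.trans e2.symm) hne
    | step hd h' =>
      have e1 := D.ext_up hd h' h.cov_aw
      have e2 := D.ext_up hd h' h.symm.cov_aw
      exact absurd (e1.trans e2.symm).le h.nwz
  | @step a q c b w z hd h ih =>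
    intro b' w' z' h'
    cases h' with
    | base h' =>
      have e1 := D.ext_up hd h h'.cov_aw
      have e2 := D.ext_up hd h h'.symm.cov_aw
      exact absurd (e1.trans e2.symm).le h'.nwz
    | step hd' h' =>
      have e1 := D.ext_up hd h (h'.cov_aq hd'.lt)
      subst e1
      have e2 := ih hd'
      subst e2
      by_contra hne
      have h1 := h.cov_cb hd.lt
      have h2 := h'.cov_cb hd'.lt
      obtain ⟨e, he⟩ := D.e1 _ _ _ h1 h2 hne
      refine D.lemN hd (.base he) fun u hu y hy => ?_
      rcases D.two h1 h2 hu hne with rfl | rfl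
      · exact D.ext_down hd h hy
      · exact D.ext_down hd' h' hy

def Rr (a b : P) : Prop := ∃ w z, DI a b w z

theorem Rr.lt {a b : P} (h : Rr a b) : a < b := by
  obtain ⟨w, z, h⟩ := h; exact h.lt

theorem Rr.not_cov {a b : P} (h : Rr a b) : ¬ a ⋖ b := by
  obtain ⟨w, z, h⟩ := h
  exact fun hc => hc.2 h.facts.2.2.1 h.facts.2.2.2.2.1

theorem DC.cov_lt (D : DC P) {a b u : P} (h : Rr a b) (hu : a ⋖ u) : u < b := by
  refine lt_of_le_of_ne ?_ ?_
  · obtain ⟨w, z, h⟩ := h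
    exact D.up_le h hu
  · rintro rfl; exact h.not_cov hu

theorem DC.Rtop (D : DC P) {a b b' : P} (h : Rr a b) (h' : Rr a b') : b = b' := by
  obtain ⟨w, z, h⟩ := h; obtain ⟨w', z', h'⟩ := h'
  exact D.top_unique h h'

theorem DC.Rbot (D : DC P) {a a' b : P} (h : Rr a b) (h' : Rr a' b) : a = a' := by
  obtain ⟨w, z, h⟩ := h; obtain ⟨w', z', h'⟩ := h'
  exact D.bot_unique h h'

theorem DC.P1 (D : DC P) {p q b : P} (h : p ⋖ q) (hb : Rr p b) : q ⋖ b ∨ ∃ c, Rr q c ∧ c ⋖ b := by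
  obtain ⟨w, z, hb⟩ := hb
  cases hb with
  | base hb =>
    rcases D.dia_up hb h with rfl | rfl
    · exact Or.inl hb.cov_wb
    · exact Or.inl hb.symm.cov_wb
  | step hd hb =>
    have := D.ext_up hd hb h
    subst this
    exact Or.inr ⟨_, ⟨_, _, hd⟩, hb.cov_cb hd.lt⟩

theorem DC.P2 (D : DC P) {p q c : P} (h : p ⋖ q) (hc : Rr q c) : ∃ b, Rr p b := by
  obtain ⟨w, z, hc⟩ := hc
  by_cases hu : ∀ u, p ⋖ u → u = q
  · obtain ⟨b, hb⟩ := D.e2 _ _ _ _ _ hc h hu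
    exact ⟨b, _, _, .step hc hb⟩
  · push Not at hu
    obtain ⟨u, h1, h2⟩ := hu
    obtain ⟨b, hb⟩ := D.e1 _ _ _ h h1 h2.symm
    exact ⟨b, _, _, .base hb⟩

theorem DC.P3 (D : DC P) {p q a : P} (h : p ⋖ q) (ha : Rr a q) : a ⋖ p ∨ ∃ r, Rr r p ∧ a ⋖ r := by
  obtain ⟨w, z, ha⟩ := ha
  cases ha with
  | base hb =>
    rcases D.dia_down hb h with rfl | rfl
    · exact Or.inl hb.cov_aw
    · exact Or.inl hb.symm.cov_aw
  | step hd hb =>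
    have := D.ext_down hd hb h
    subst this
    exact Or.inr ⟨_, ⟨_, _, hd⟩, hb.cov_aq hd.lt⟩

abbrev RT (a b : P) : Prop := Relation.ReflTransGen Rr a b

theorem RT.le {a b : P} (h : RT a b) : a ≤ b := by
  induction h with
  | refl => exact le_rfl
  | tail _ h ih => exact ih.trans h.lt.le

theorem diag_eq {a b : P} : DiagRel a b ↔ Relation.EqvGen Rr a b := by
  unfold DiagRel
  have : (fun x y : P => IsDInterval x y) = Rr := by
    funext x y; exact propext isDI_iff
  rw [this]

theorem RT.diag {a b : P} (h : RT a b) : DiagRel a b := by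
  rw [diag_eq]
  induction h with
  | refl => exact .refl _
  | tail _ h ih => exact .trans _ _ _ ih (.rel _ _ h)

theorem DC.diag (D : DC P) {a b : P} : DiagRel a b ↔ RT a b ∨ RT b a := by
  constructor
  · intro h
    rw [diag_eq] at h
    induction h with
    | rel x y h => exact Or.inl (.single h)
    | refl x => exact Or.inl .refl
    | symm x y _ ih => exact ih.symm
    | trans x y z _ _ ih1 ih2 =>
      rcases ih1 with h1 | h1 <;> rcases ih2 with h2 | h2
      · exact Or.inl (h1.trans h2)
      · have h1' := h1.swap
        have h2' := h2.swap
        have := Relation.ReflTransGen.total_of_right_unique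
          (fun a b c (h : Rr b a) (h' : Rr c a) => D.Rbot h h') h1' h2'
        rcases this with h | h
        · exact Or.inr (Relation.reflTransGen_swap.1 h)
        · exact Or.inl (Relation.reflTransGen_swap.1 h)
      · exact Relation.ReflTransGen.total_of_right_unique
          (fun a b c (h : Rr a b) (h' : Rr a c) => D.Rtop h h') h1 h2
      · exact Or.inr (h2.trans h1)
  · rintro (h | h)
    · exact h.diag
    · exact (Relation.EqvGen.is_equivalence _).symm h.diag

end PartB

section PartC
variable {P : Type*} [PartialOrder P] [Fintype P]

/-- the good position of two elements of adjacent diagonals -/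
def Pos (x y : P) : Prop :=
  (x < y ∨ y < x) ∧
  (x < y → (∀ t, DiagRel x t → x < t → ¬ t ≤ y) → ∃ u, DiagRel y u ∧ x ⋖ u) ∧
  (y < x → (∀ t, DiagRel y t → y < t → ¬ t ≤ x) → ∃ u, DiagRel x u ∧ y ⋖ u)

theorem Pos.symm {x y : P} (h : Pos x y) : Pos y x := ⟨h.1.symm, h.2.2, h.2.1⟩

theorem dsymm {a b : P} (h : DiagRel a b) : DiagRel b a := (Relation.EqvGen.is_equivalence _).symm h
theorem dtrans {a b c : P} (h : DiagRel a b) (h' : DiagRel b c) : DiagRel a c :=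
  (Relation.EqvGen.is_equivalence _).trans h h'

/-- easy case -/
theorem pos_easy {p q x y : P} (h : p ⋖ q) (hx : RT x p) (hy : RT q y) : Pos x y := by
  have hxy : x < y := (hx.le.trans_lt h.lt).trans_le hy.le
  refine ⟨Or.inl hxy, fun _ ht => ?_, fun h' => absurd h' hxy.not_gt⟩
  rcases hx.le.eq_or_lt with e | e
  · subst e
    exact ⟨q, dsymm hy.diag, h⟩
  · exact absurd (h.le.trans hy.le) (ht p hx.diag e)

theorem RT.top {a b x : P} (D : DC P) (h : Rr a b) (hx : RT a x) : x = a ∨ RT b x := by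
  rcases Relation.ReflTransGen.cases_head hx with e | ⟨c, h1, h2⟩
  · exact Or.inl e.symm
  · rw [← D.Rtop h h1] at h2; exact Or.inr h2

theorem RT.bot {a b x : P} (D : DC P) (h : Rr a b) (hx : RT x b) : x = b ∨ RT x a := by
  rcases Relation.ReflTransGen.cases_tail hx with e | ⟨c, h1, h2⟩
  · exact Or.inl e.symm
  · rw [← D.Rbot h h2] at h1; exact Or.inr h1

theorem RT.notop {a x : P} (h : ¬ ∃ b, Rr a b) (hx : RT a x) : x = a := by
  rcases Relation.ReflTransGen.cases_head hx with e | ⟨c, h1, h2⟩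
  · exact e.symm
  · exact absurd ⟨c, h1⟩ h

theorem RT.nobot {b x : P} (h : ¬ ∃ a, Rr a b) (hx : RT x b) : x = b := by
  rcases Relation.ReflTransGen.cases_tail hx with e | ⟨c, h1, h2⟩
  · exact e.symm
  · exact absurd ⟨c, h2⟩ h

theorem DC.up_pos (D : DC P) (p : P) : ∀ q, p ⋖ q → ∀ x y, RT p x → RT q y → Pos x y := by
  induction p using WellFoundedGT.induction with
  | ind p ih =>
    intro q h x y hx hy
    by_cases hp : ∃ b, Rr p b
    · obtain ⟨b, hb⟩ := hp
      rcases RT.top D hb hx with rfl | hbx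
      · exact pos_easy h .refl hy
      rcases D.P1 h hb with h1 | ⟨c, hc, h1⟩
      · exact (ih q h.lt b h1 y x hy hbx).symm
      · rcases RT.top D hc hy with rfl | hcy
        · have hlt : c < x := h1.lt.trans_le hbx.le
          refine ⟨Or.inr (hc.lt.trans hlt), fun h' => absurd h' (hc.lt.trans hlt).not_gt, fun _ ht => ?_⟩
          exact absurd hlt.le (ht c (RT.diag (.single hc)) hc.lt)
        · exact (ih c (h.lt.trans hc.lt) b h1 y x hcy hbx).symm
    · rw [RT.notop hp hx]
      exact pos_easy h .refl hy

theorem DC.dn_pos (D : DC P) (q : P) : ∀ p, p ⋖ q → ∀ x y, RT x p → RT y q → Pos x y := by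
  induction q using WellFoundedLT.induction with
  | ind q ih =>
    intro p h x y hx hy
    by_cases hq : ∃ a, Rr a q
    · obtain ⟨a, ha⟩ := hq
      rcases RT.bot D ha hy with rfl | hya
      · exact pos_easy h hx .refl
      rcases D.P3 h ha with h1 | ⟨r, hr, h1⟩
      · exact (ih p h.lt a h1 y x hya hx).symm
      · rcases RT.bot D hr hx with rfl | hxr
        · exact (pos_easy h1 hya (.single hr)).symm
        · exact (ih r (hr.lt.trans h.lt) a h1 y x hya hxr).symm
    · rw [RT.nobot hq hy]
      exact pos_easy h hx .refl

theorem DC.pos (D : DC P) {p q x y : P} (h : p ⋖ q) (hx : DiagRel p x) (hy : DiagRel q y) : Pos x y := by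
  rcases D.diag.1 hx with hx | hx <;> rcases D.diag.1 hy with hy | hy
  · exact D.up_pos p q h x y hx hy
  · by_cases hp : ∃ b, Rr p b
    · obtain ⟨b, hb⟩ := hp
      rcases RT.top D hb hx with rfl | hbx
      · exact D.dn_pos q _ h _ y .refl hy
      have hqx : q < x := (D.cov_lt hb h).trans_le hbx.le
      rcases hy.le.eq_or_lt with e | e
      · subst e
        exact D.up_pos p _ h x _ hx .refl
      · refine ⟨Or.inr (e.trans hqx), fun h' => absurd h' (e.trans hqx).not_gt, fun _ ht => ?_⟩
        exact absurd hqx.le (ht q hy.diag e)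
    · rw [RT.notop hp hx]
      exact D.dn_pos q p h p y .refl hy
  · exact pos_easy h hx hy
  · exact D.dn_pos q p h x y hx hy

abbrev dlab (p : P) : Quotient (diagSetoid P) := Quotient.mk (diagSetoid P) p

theorem dlab_eq {p q : P} : dlab p = dlab q ↔ DiagRel p q :=
  Quotient.eq (r := diagSetoid P)

def DAdj (i j : Quotient (diagSetoid P)) : Prop :=
  ∃ p q : P, dlab p = i ∧ dlab q = j ∧ (p ⋖ q ∨ q ⋖ p)

theorem DC.adj_pos (D : DC P) {x y : P} (h : DAdj (dlab x) (dlab y)) : Pos x y := by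
  obtain ⟨p, q, h1, h2, h3 | h3⟩ := h
  · exact D.pos h3 (dlab_eq.1 h1) (dlab_eq.1 h2)
  · exact (D.pos h3 (dlab_eq.1 h2) (dlab_eq.1 h1)).symm

theorem DC.cons (D : DC P) {a b : P} (hab : a < b) (hl : dlab a = dlab b)
    (hc : ∀ c, a < c → c < b → dlab c ≠ dlab a) : Rr a b := by
  rcases D.diag.1 (dlab_eq.1 hl) with h | h
  · rcases Relation.ReflTransGen.cases_head h with e | ⟨c, h1, h2⟩
    · exact absurd e hab.ne
    · rcases (RT.le h2).eq_or_lt with e | e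
      · rw [← e]; exact h1
      · exact absurd (dlab_eq.2 (dsymm (RT.diag (.single h1)))) (hc c h1.lt e)
  · exact absurd h.le hab.not_ge

/-- the adjacent elements strictly inside a d-interval -/
theorem inside_dia {a b w z : P} (h : Dia a b w z) :
    Finset.univ.filter (fun r => a < r ∧ r < b ∧ DAdj (dlab a) (dlab r)) = {w, z} := by
  ext r
  simp only [Finset.mem_filter, Finset.mem_univ, true_and, Finset.mem_insert, Finset.mem_singleton]
  constructor
  · rintro ⟨h1, h2, _⟩
    rcases h.all r h1.le h2.le with h3 | h3 | h3
    · exact absurd h3 h1.ne'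
    · exact absurd h3 h2.ne
    · exact h3
  · rintro (rfl | rfl)
    · exact ⟨h.aw, h.wb, a, _, rfl, rfl, Or.inl h.cov_aw⟩
    · exact ⟨h.az, h.zb, a, _, rfl, rfl, Or.inl h.symm.cov_aw⟩

theorem DC.inside_ext (D : DC P) {a q c b w z : P} (hd : DI q c w z) (h : DExt a q c b) :
    Finset.univ.filter (fun r => a < r ∧ r < b ∧ DAdj (dlab a) (dlab r)) = {q, c} := by
  have hR : Rr a b := ⟨_, _, .step hd h⟩
  have hqc : Rr q c := ⟨_, _, hd⟩
  have haq := h.cov_aq hd.lt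
  ext r
  simp only [Finset.mem_filter, Finset.mem_univ, true_and, Finset.mem_insert, Finset.mem_singleton]
  constructor
  · rintro ⟨h1, h2, h3⟩
    obtain ⟨u, hu, hau⟩ := (D.adj_pos h3).2.1 h1 (by
      intro t ht hat htr
      rcases D.diag.1 ht with h4 | h4
      · rcases RT.top D hR h4 with e | h5
        · exact hat.ne' e
        · exact (htr.trans_lt h2).not_ge h5.le
      · exact hat.not_ge h4.le)
    have := D.ext_up hd h hau
    subst this
    rcases h.all r h1.le h2.le with h3 | h3 | h3
    · exact absurd h3 h1.ne'
    · exact absurd h3 h2.ne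
    · rcases D.diag.1 hu with h4 | h4
      · exact Or.inl (le_antisymm h4.le h3.1)
      · rcases RT.top D hqc h4 with e | h5
        · exact Or.inl e
        · exact Or.inr (le_antisymm h3.2 h5.le)
  · rintro (rfl | rfl)
    · exact ⟨h.aq, hd.lt.trans h.cb, a, _, rfl, rfl, Or.inl haq⟩
    · exact ⟨h.aq.trans hd.lt, h.cb, a, q, rfl, dlab_eq.2 (RT.diag (.single hqc)), Or.inl haq⟩

theorem DC.heap (D : DC P) : HeapAx (P := P) dlab DAdj := by
  constructor
  · rintro i j ⟨p, q, h1, h2, h3⟩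
    exact ⟨q, p, h2, h1, h3.symm⟩
  · rintro i ⟨p, q, h1, h2, h3⟩
    have aux : ∀ p q : P, DiagRel p q → ¬ p ⋖ q := by
      intro p q h hc
      rcases D.diag.1 h with h | h
      · rcases Relation.ReflTransGen.cases_head h with e | ⟨c, h4, h5⟩
        · exact hc.lt.ne e
        · exact (D.cov_lt h4 hc).not_ge (RT.le h5)
      · exact hc.lt.not_ge h.le
    have h := dlab_eq.1 (h1.trans h2.symm)
    rcases h3 with h3 | h3
    · exact aux _ _ h h3
    · exact aux _ _ (dsymm h) h3
  · intro a b h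
    rcases D.diag.1 (dlab_eq.1 h) with h | h
    · exact Or.inl h.le
    · exact Or.inr h.le
  · intro a b h
    rcases (D.adj_pos h).1 with h | h
    · exact Or.inl h.le
    · exact Or.inr h.le
  · intro a b h
    exact ⟨a, b, rfl, rfl, Or.inl h⟩
  · intro a b hab hl hc
    obtain ⟨w, z, h⟩ := D.cons hab hl hc
    cases h with
    | base h =>
      rw [inside_dia h]
      exact Finset.card_pair (fun e => h.nwz e.le)
    | step hd h =>
      rw [D.inside_ext hd h]
      exact Finset.card_pair hd.lt.ne
  · intro a ha
    have hno : ¬ ∃ b, Rr a b := by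
      rintro ⟨b, hb⟩
      exact ha b hb.lt (dlab_eq.2 (dsymm (RT.diag (.single hb))))
    have hcov : ∀ r, a < r → DAdj (dlab a) (dlab r) → a ⋖ r := by
      intro r har h
      obtain ⟨u, hu, hau⟩ := (D.adj_pos h).2.1 har (by
        intro t ht hat
        exact absurd (dlab_eq.2 (dsymm ht)) (ha t hat))
      have hun : ¬ ∃ c, Rr u c := fun ⟨c, hc⟩ => hno (D.P2 hau hc)
      rcases D.diag.1 hu with h4 | h4
      · rcases h4.le.eq_or_lt with e | e
        · rw [e]; exact hau
        · exact absurd e (hau.2 har)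
      · rw [RT.notop hun h4]; exact hau
    rw [Finset.card_le_one]
    intro r hr s hs
    simp only [Finset.mem_filter, Finset.mem_univ, true_and] at hr hs
    by_contra hne
    obtain ⟨b, hb⟩ := D.e1 _ _ _ (hcov r hr.1 hr.2) (hcov s hs.1 hs.2) hne
    exact hno ⟨b, _, _, .base hb⟩

/-- a neck element is the top of a d-interval -/
theorem DI.neck {a b w z : P} (h : DI a b w z) : ∀ {p : P}, a ≤ p → p ≤ b → w ≤ p → z ≤ p →
    ∃ a', Rr a' p := by
  induction h with
  | @base a b w z h =>
    intro p h1 h2 h3 h4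
    rcases h.all p h1 h2 with rfl | rfl | rfl | rfl
    · exact absurd h3 h.aw.not_ge
    · exact ⟨a, w, z, .base h⟩
    · exact absurd h4 h.nzw
    · exact absurd h3 h.nwz
  | @step a q c b w z hd h ih =>
    intro p h1 h2 h3 h4
    rcases h.all p h1 h2 with rfl | rfl | h5
    · exact absurd h3 (h.aq.trans hd.facts.2.2.1).not_ge
    · exact ⟨a, w, z, .step hd h⟩
    · exact ih h5.1 h5.2 h3 h4

theorem Rr.no_between (D : DC P) {a b : P} (h : Rr a b) : ∀ c, a < c → c < b → dlab c ≠ dlab a := by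
  intro c h1 h2 hl
  rcases D.diag.1 (dlab_eq.1 hl) with h4 | h4
  · exact h1.not_ge h4.le
  · rcases RT.top D h h4 with e | h5
    · exact h1.ne' e
    · exact h2.not_ge h5.le

theorem DC.beta_rec (D : DC P) {M : Type*} [AddCommGroup M] {β : P → M}
    (hβ : ∀ a b, a < b → dlab a = dlab b → (∀ c, a < c → c < b → dlab c ≠ dlab a) →
        β b = ∑ r ∈ Finset.univ.filter (fun r => a < r ∧ r < b ∧ DAdj (dlab a) (dlab r)), β r - β a)
    {a b w z : P} (h : DI a b w z) : β b = β w + β z - β a := by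
  induction h with
  | @base a b w z h =>
    have hR : Rr a b := ⟨_, _, .base h⟩
    rw [hβ a b hR.lt (dlab_eq.2 (RT.diag (.single hR))) (hR.no_between D), inside_dia h,
      Finset.sum_pair (fun e => h.nwz e.le)]
  | @step a q c b w z hd h ih =>
    have hR : Rr a b := ⟨_, _, .step hd h⟩
    rw [hβ a b hR.lt (dlab_eq.2 (RT.diag (.single hR))) (hR.no_between D), D.inside_ext hd h,
      Finset.sum_pair hd.lt.ne, ih]
    abel

end PartC

/-- Multivariate hook length formula for d-complete posets: in the field of
rational functions in indeterminates `X D` indexed by the diagonals of `P`, the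
sum of the weights of the linear extensions of `P` equals the reciprocal of the
product of the hook polynomials `H_p = ∑_D h_P^{(D)}(p) X D`. -/
theorem multivariate_hook_length_formula {P : Type*} [PartialOrder P] [Fintype P]
    (hP : IsDComplete P) (h : P → Quotient (diagSetoid P) → ℤ)
    (hh : IsHookVector h) :
    (∑ e ∈ Finset.univ.filter (fun e : Fin (Fintype.card P) ≃ P => IsLinExt e),
        (∏ i : Fin (Fintype.card P),
          ∑ j ∈ Finset.univ.filter (fun j => i ≤ j),
            algebraMap (MvPolynomial (Quotient (diagSetoid P)) ℚ)
              (FractionRing (MvPolynomial (Quotient (diagSetoid P)) ℚ))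
              (MvPolynomial.X (Quotient.mk (diagSetoid P) (e j))))⁻¹)
      = (∏ p : P, ∑ D : Quotient (diagSetoid P),
          (h p D : FractionRing (MvPolynomial (Quotient (diagSetoid P)) ℚ)) *
            algebraMap (MvPolynomial (Quotient (diagSetoid P)) ℚ)
              (FractionRing (MvPolynomial (Quotient (diagSetoid P)) ℚ))
              (MvPolynomial.X D))⁻¹ := by
  have D := hP.dc
  obtain ⟨β, h1, h2, h3⟩ := heap_formula D.heap
  have key : ∀ p : P, ∑ D : Quotient (diagSetoid P),
      (h p D : MvPolynomial (Quotient (diagSetoid P)) ℚ) * MvPolynomial.X D = β p := by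
    intro p
    induction p using WellFoundedLT.induction with
    | ind p ih =>
      by_cases hn : ∃ a, Rr a p
      · obtain ⟨a, w, z, hd⟩ := hn
        obtain ⟨_, _, f1, f2, f3, f4⟩ := hd.facts
        rw [D.beta_rec h2 hd, ← ih w f3, ← ih z f4, ← ih a hd.lt, ← Finset.sum_add_distrib,
          ← Finset.sum_sub_distrib]
        refine Finset.sum_congr rfl fun E _ => ?_
        rw [hh.2 a p w z (isDIW_iff.2 hd) E]
        push_cast; ring
      · rw [h3 p]
        · have hnn : ¬ ∃ a b : P, IsNeckOf p a b := by
            rintro ⟨a, b, k, w, z, hk, hp, hw, hz⟩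
            exact hn ((isDIW_iff.1 ⟨k, hk⟩).neck hp.1 hp.2 hw hz)
          rw [← Finset.sum_fiberwise (Finset.univ.filter (· ≤ p)) dlab]
          refine Finset.sum_congr rfl fun E _ => ?_
          rw [hh.1 p hnn E]
          have : {r : P | Quotient.mk (diagSetoid P) r = E ∧ r ≤ p} =
              (((Finset.univ.filter (· ≤ p)).filter (fun r => dlab r = E) : Finset P) : Set P) := by
            ext r
            simp [and_comm]
          rw [this, Set.ncard_coe_finset]
          rw [Finset.sum_congr rfl (g := fun _ => MvPolynomial.X E)]
          · simp
          · intro r hr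
            rw [(Finset.mem_filter.1 hr).2]
        · intro a hap hl
          rcases D.diag.1 (dlab_eq.1 hl) with h4 | h4
          · exact hap.ne (RT.nobot hn h4)
          · exact hap.not_ge h4.le
  refine (Finset.sum_congr ?_ fun _ _ => rfl).trans (h1.trans ?_)
  · ext e
    rw [Finset.mem_filter, Finset.mem_filter]
    rfl
  congr 1
  refine Finset.prod_congr rfl fun p _ => ?_
  rw [← key p, map_sum]
  refine Finset.sum_congr rfl fun E _ => ?_
  rw [map_mul, map_intCast]
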